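/- arXiv:2404.19681 — 10 statements merged into one kernel-verified Lean document; each statement's English description precedes it below -/
import Mathlib

section
/- Let X, Y, M₁, M₂ be proper metric spaces, let f₁ : X → M₁, f₂ : X → M₂, g₁ : Y → M₁, g₂ : Y → M₂ be isometric embeddings, and let ε ≥ 0 satisfy dist(f₂(x), g₂(y)) ≤ dist(f₁(x), g₁(y)) + ε for all x ∈ X, y ∈ Y. Then for every closed A ⊆ X, x ∈ X, closed B ⊆ Y, y ∈ Y one has, with values in [0,∞], max( dist(f₂(x), g₂(y)), ∫_{(0,∞)} e^{−r} · min(1, dHe(f₂''A ∩ B̄(f₂(x),r), g₂''B ∩ B̄(g₂(y),r))) dr ) ≤ max( dist(f₁(x), g₁(y)), ∫_{(0,∞)} e^{−r} · min(1, dHe(f₁''A ∩ B̄(f₁(x),r), g₁''B ∩ B̄(g₁(y),r))) dr ) + ε. -/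
open Metric Set MeasureTheory Filter
open scoped ENNReal

/-- The rooted local Hausdorff distance (with values in `ℝ≥0∞`) between pairs
`(closed set, basepoint)` in a metric space: the maximum of the distance between the
basepoints and `∫_{(0,∞)} e^{-r} · min(1, dHe(A ∩ B̄(x,r), B ∩ B̄(y,r))) dr`. -/
noncomputable def rootedLocalHausdorffEDist {M : Type*} [PseudoMetricSpace M]
    (A : Set M) (x : M) (B : Set M) (y : M) : ℝ≥0∞ :=
  max (edist x y)
    (∫⁻ r in Set.Ioi (0 : ℝ),
      ENNReal.ofReal (Real.exp (-r)) *
        min 1 (EMetric.hausdorffEdist (A ∩ Metric.closedBall x r) (B ∩ Metric.closedBall y r)))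

/-- If passing from `(f₁, g₁)` to `(f₂, g₂)` increases the distances between values by at most `δ`,
then it increases the distances from values to image sets by at most `δ`. -/
lemma infEDist_image_le_add {X Y M₁ M₂ : Type*} [PseudoEMetricSpace M₁] [PseudoEMetricSpace M₂]
    {f₁ : X → M₁} {f₂ : X → M₂} {g₁ : Y → M₁} {g₂ : Y → M₂} {δ : ℝ≥0∞}
    (h : ∀ x y, edist (f₂ x) (g₂ y) ≤ edist (f₁ x) (g₁ y) + δ) (x : X) (T : Set Y) :
    infEDist (f₂ x) (g₂ '' T) ≤ infEDist (f₁ x) (g₁ '' T) + δ := by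
  rw [← tsub_le_iff_right, le_infEDist]
  rintro _ ⟨y, hy, rfl⟩
  rw [tsub_le_iff_right]
  exact (infEDist_le_edist_of_mem (mem_image_of_mem g₂ hy)).trans (h x y)

lemma hausdorffEDist_image_le_add {X Y M₁ M₂ : Type*} [PseudoEMetricSpace M₁]
    [PseudoEMetricSpace M₂] {f₁ : X → M₁} {f₂ : X → M₂} {g₁ : Y → M₁} {g₂ : Y → M₂} {δ : ℝ≥0∞}
    (h : ∀ x y, edist (f₂ x) (g₂ y) ≤ edist (f₁ x) (g₁ y) + δ) (S : Set X) (T : Set Y) :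
    hausdorffEDist (f₂ '' S) (g₂ '' T) ≤ hausdorffEDist (f₁ '' S) (g₁ '' T) + δ := by
  have h' : ∀ y x, edist (g₂ y) (f₂ x) ≤ edist (g₁ y) (f₁ x) + δ := fun y x ↦ by
    simpa only [edist_comm] using h x y
  apply hausdorffEDist_le_of_infEDist
  · rintro _ ⟨a, ha, rfl⟩
    refine (infEDist_image_le_add h a T).trans ?_
    gcongr
    exact infEDist_le_hausdorffEDist_of_mem (mem_image_of_mem f₁ ha)
  · rintro _ ⟨b, hb, rfl⟩
    refine (infEDist_image_le_add h' b S).trans ?_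
    gcongr
    rw [hausdorffEDist_comm]
    exact infEDist_le_hausdorffEDist_of_mem (mem_image_of_mem g₁ hb)

lemma Isometry.image_inter_closedBall {X M : Type*} [PseudoMetricSpace X] [PseudoMetricSpace M]
    {f : X → M} (hf : Isometry f) (A : Set X) (x : X) (r : ℝ) :
    f '' A ∩ closedBall (f x) r = f '' (A ∩ closedBall x r) := by
  rw [← hf.preimage_closedBall, image_inter_preimage]

lemma lintegral_exp_neg_Ioi_zero :
    ∫⁻ r in Ioi (0 : ℝ), ENNReal.ofReal (Real.exp (-r)) = 1 := by
  rw [← ofReal_integral_eq_lintegral_ofReal (integrableOn_exp_neg_Ioi 0)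
    (ae_of_all _ fun r ↦ (Real.exp_pos _).le), integral_exp_neg_Ioi_zero, ENNReal.ofReal_one]

/-- **Stability of the rooted local Hausdorff distance under ε-deformations of the
ambient space.** For isometric embeddings `f₁, f₂, g₁, g₂` of proper metric spaces with
`dist (f₂ x) (g₂ y) ≤ dist (f₁ x) (g₁ y) + ε`, the rooted local Hausdorff distance of
the images in `M₂` is at most that in `M₁` plus `ε`. -/
theorem rootedLocalHausdorffEDist_le_of_dist_le
    {X Y M₁ M₂ : Type*} [MetricSpace X] [ProperSpace X] [MetricSpace Y] [ProperSpace Y]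
    [MetricSpace M₁] [ProperSpace M₁] [MetricSpace M₂] [ProperSpace M₂]
    {f₁ : X → M₁} {f₂ : X → M₂} {g₁ : Y → M₁} {g₂ : Y → M₂}
    (hf₁ : Isometry f₁) (hf₂ : Isometry f₂) (hg₁ : Isometry g₁) (hg₂ : Isometry g₂)
    {ε : ℝ} (hε : 0 ≤ ε)
    (h : ∀ (x : X) (y : Y), dist (f₂ x) (g₂ y) ≤ dist (f₁ x) (g₁ y) + ε)
    (A : Set X) (hA : IsClosed A) (x : X) (B : Set Y) (hB : IsClosed B) (y : Y) :
    rootedLocalHausdorffEDist (f₂ '' A) (f₂ x) (g₂ '' B) (g₂ y)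
      ≤ rootedLocalHausdorffEDist (f₁ '' A) (f₁ x) (g₁ '' B) (g₁ y) + ENNReal.ofReal ε := by
  have hed : ∀ a b, edist (f₂ a) (g₂ b) ≤ edist (f₁ a) (g₁ b) + ENNReal.ofReal ε := fun a b ↦ by
    rw [edist_dist, edist_dist, ← ENNReal.ofReal_add dist_nonneg hε]
    exact ENNReal.ofReal_le_ofReal (h a b)
  unfold rootedLocalHausdorffEDist
  simp only [hf₁.image_inter_closedBall, hf₂.image_inter_closedBall, hg₁.image_inter_closedBall,
    hg₂.image_inter_closedBall]
  rw [← max_add_add_right]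
  refine max_le_max (hed x y) ?_
  have hmeas : Measurable fun r : ℝ ↦ ENNReal.ofReal (Real.exp (-r)) := by fun_prop
  calc
    _ ≤ ∫⁻ r in Ioi (0 : ℝ), (ENNReal.ofReal (Real.exp (-r)) *
          min 1 (hausdorffEDist (f₁ '' (A ∩ closedBall x r)) (g₁ '' (B ∩ closedBall y r))) +
        ENNReal.ofReal (Real.exp (-r)) * ENNReal.ofReal ε) := by
      refine lintegral_mono fun r ↦ ?_
      rw [← mul_add, ← min_add_add_right]
      gcongr
      · exact le_self_add
      · exact hausdorffEDist_image_le_add hed _ _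
    _ = _ := by
      rw [lintegral_add_right _ (hmeas.mul_const _), lintegral_mul_const _ hmeas,
        lintegral_exp_neg_Ioi_zero, one_mul]
      rfl
end

section
/- Let X be a proper metric space and ρ ∈ X. For closed subsets A, B ⊆ X define D_ρ(A,B) := ∫_{(0,∞)} e^{−r} · min(1, dHe(A ∩ B̄(ρ,r), B ∩ B̄(ρ,r))) dr. Then: (a) D_ρ(A,B) = D_ρ(B,A) for all closed A, B; (b) D_ρ(A,B) = 0 if and only if A = B; (c) D_ρ(A,C) ≤ D_ρ(A,B) + D_ρ(B,C) for all closed A, B, C; (d) D_ρ is complete: for every sequence (A_n) of closed subsets of X such that for every ε > 0 there is N with D_ρ(A_m, A_n) < ε for all m, n ≥ N, there exists a closed subset A ⊆ X with D_ρ(A_n, A) → 0; (e) D_ρ is separable: there is a countable family 𝒟 of closed subsets of X such that for every closed A ⊆ X and every ε > 0 there is B ∈ 𝒟 with D_ρ(A,B) < ε. -/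
open Metric Set MeasureTheory Filter
open scoped ENNReal Topology

/-- The local Hausdorff distance with basepoint `ρ` between closed subsets of a metric
space: `D_ρ(A,B) := ∫_{(0,∞)} e^{-r} · min(1, dHe(A ∩ B̄(ρ,r), B ∩ B̄(ρ,r))) dr`,
with values in `ℝ≥0∞`. -/
noncomputable def localHausdorffDist {X : Type*} [PseudoMetricSpace X] (ρ : X)
    (A B : Set X) : ℝ≥0∞ :=
  ∫⁻ r in Set.Ioi (0 : ℝ),
    ENNReal.ofReal (Real.exp (-r)) *
      min 1 (EMetric.hausdorffEdist (A ∩ Metric.closedBall ρ r) (B ∩ Metric.closedBall ρ r))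

theorem localHausdorffDist_def {X : Type*} [PseudoMetricSpace X] (ρ : X) (A B : Set X) :
    localHausdorffDist ρ A B = ∫⁻ r in Ioi (0 : ℝ), ENNReal.ofReal (Real.exp (-r)) *
      min 1 (hausdorffEDist (A ∩ closedBall ρ r) (B ∩ closedBall ρ r)) :=
  rfl

theorem localHausdorffDist_comm {X : Type*} [PseudoMetricSpace X] (ρ : X) (A B : Set X) :
    localHausdorffDist ρ A B = localHausdorffDist ρ B A := by
  simp only [localHausdorffDist_def, hausdorffEDist_comm]

theorem localHausdorffDist_self {X : Type*} [PseudoMetricSpace X] (ρ : X) (A : Set X) :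
    localHausdorffDist ρ A A = 0 := by
  simp [localHausdorffDist_def]

/-- A set of reals that contains a right neighbourhood of each of its points is Borel. -/
theorem measurableSet_of_forall_mem_nhdsGT {S : Set ℝ} (h : ∀ x ∈ S, S ∈ 𝓝[>] x) :
    MeasurableSet S := by
  have hc : (S \ interior S).Countable := by
    refine (countable_setOfPred_isolated_right_within (s := (interior S)ᶜ)).mono ?_
    rintro x ⟨hxS, hx⟩
    obtain ⟨y, hxy, hy⟩ := (mem_nhdsGT_iff_exists_Ioo_subset).1 (h x hxS)
    refine mem_ofPred.2 ⟨hx, ?_⟩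
    rw [← empty_mem_iff_bot, inter_comm, nhdsWithin_inter']
    refine mem_inf_of_inter (Ioo_mem_nhdsGT hxy) (mem_principal_self _) ?_
    exact fun z hz => hz.2 (interior_maximal hy isOpen_Ioo hz.1)
  rw [← sdiff_union_of_subset (interior_subset (s := S))]
  exact hc.measurableSet.union isOpen_interior.measurableSet

/-- The values of a function at its local minima along a set form a countable set. -/
theorem countable_image_isLocalMinOn {X : Type*} [TopologicalSpace X]
    [SecondCountableTopology X] (f : X → ℝ) (L : Set X) :
    (f '' {x | x ∈ L ∧ IsLocalMinOn f L x}).Countable := by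
  refine ((TopologicalSpace.countable_countableBasis X).image
    fun U => sInf (f '' (U ∩ L))).mono ?_
  rintro _ ⟨x, ⟨hxL, hx⟩, rfl⟩
  obtain ⟨V, hV, hVmin⟩ := mem_nhdsWithin_iff_exists_mem_nhds_inter.1 hx
  obtain ⟨U, hU, hxU, hUV⟩ :=
    (TopologicalSpace.isBasis_countableBasis X).mem_nhds_iff.1 hV
  refine ⟨U, hU, ?_⟩
  refine IsLeast.csInf_eq ⟨⟨x, ⟨hxU, hxL⟩, rfl⟩, ?_⟩
  rintro _ ⟨y, ⟨hyU, hyL⟩, rfl⟩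
  exact hVmin ⟨hUV hyU, hyL⟩

section ProperSpace

variable {X : Type*} [MetricSpace X] [ProperSpace X]

theorem eventually_lt_infEDist_inter_closedBall {B : Set X} (hB : IsClosed B) (ρ x : X) {r : ℝ}
    {c : ℝ≥0∞} (h : c < infEDist x (B ∩ closedBall ρ r)) :
    ∀ᶠ s in 𝓝[>] r, c < infEDist x (B ∩ closedBall ρ s) := by
  obtain ⟨c', hc, hc'⟩ := exists_between h
  have hK : IsCompact (B ∩ closedBall ρ (r + 1) ∩ {y | edist x y ≤ c'}) :=
    ((isCompact_closedBall ρ (r + 1)).inter_left hB).inter_right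
      (isClosed_le (by fun_prop) continuous_const)
  have hev : ∀ᶠ s in 𝓝 r, ∀ y ∈ B ∩ closedBall ρ (r + 1) ∩ {y | edist x y ≤ c'},
      s < dist y ρ := by
    refine hK.eventually_forall_of_forall_eventually (P := fun s y => s < dist y ρ) ?_
    rintro y ⟨⟨hyB, -⟩, hyc⟩
    have hy : r < dist y ρ := by
      by_contra! hle
      exact absurd (infEDist_le_edist_of_mem (x := x) (mem_inter hyB (mem_closedBall.2 hle)))
        (not_le.2 (lt_of_le_of_lt hyc hc'))
    exact (isOpen_lt continuous_fst (by fun_prop)).mem_nhds hy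
  filter_upwards [nhdsWithin_le_nhds hev,
    nhdsWithin_le_nhds (Iio_mem_nhds (show r < r + 1 by linarith))] with s hs hs1
  refine hc.trans_le (le_iInf₂ fun y hy => ?_)
  by_contra! hlt
  exact absurd (hs y ⟨⟨hy.1, closedBall_subset_closedBall (le_of_lt hs1) hy.2⟩, hlt.le⟩)
    (not_lt.2 hy.2)

theorem measurable_hausdorffEDist_inter_closedBall {A B : Set X} (hA : IsClosed A)
    (hB : IsClosed B) (ρ : X) :
    Measurable fun r : ℝ => hausdorffEDist (A ∩ closedBall ρ r) (B ∩ closedBall ρ r) := by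
  refine measurable_of_Ioi fun c => measurableSet_of_forall_mem_nhdsGT fun r hr => ?_
  have key : ∀ {A B : Set X}, IsClosed B → ∀ x ∈ A ∩ closedBall ρ r,
      c < infEDist x (B ∩ closedBall ρ r) →
      ∀ᶠ s in 𝓝[>] r, c < hausdorffEDist (A ∩ closedBall ρ s) (B ∩ closedBall ρ s) := by
    intro A B hB x hx hc
    filter_upwards [eventually_lt_infEDist_inter_closedBall hB ρ x hc, self_mem_nhdsWithin]
      with s hs hrs
    exact hs.trans_le (infEDist_le_hausdorffEDist_of_mem
      ⟨hx.1, closedBall_subset_closedBall (le_of_lt hrs) hx.2⟩)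
  have hr' : c < hausdorffEDist (A ∩ closedBall ρ r) (B ∩ closedBall ρ r) := hr
  rw [hausdorffEDist_def, lt_sup_iff] at hr'
  simp only [lt_iSup_iff] at hr'
  rcases hr' with ⟨x, hx, hc⟩ | ⟨x, hx, hc⟩
  · exact key hB x hx hc
  · filter_upwards [key hA x hx hc] with s hs
    rwa [mem_preimage, hausdorffEDist_comm]

theorem measurable_localHausdorffDist_integrand {A B : Set X} (hA : IsClosed A)
    (hB : IsClosed B) (ρ : X) :
    Measurable fun r : ℝ => ENNReal.ofReal (Real.exp (-r)) *
      min 1 (hausdorffEDist (A ∩ closedBall ρ r) (B ∩ closedBall ρ r)) :=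
  (by fun_prop : Measurable fun r : ℝ => ENNReal.ofReal (Real.exp (-r))).mul
    (measurable_const.min (measurable_hausdorffEDist_inter_closedBall hA hB ρ))

theorem localHausdorffDist_eq_zero_iff (ρ : X) {A B : Set X} (hA : IsClosed A)
    (hB : IsClosed B) : localHausdorffDist ρ A B = 0 ↔ A = B := by
  refine ⟨fun h => ?_, fun h => h ▸ localHausdorffDist_self ρ A⟩
  have h0 := (lintegral_eq_zero_iff (measurable_localHausdorffDist_integrand hA hB ρ)).1 h
  rw [Filter.EventuallyEq, ae_restrict_iff' measurableSet_Ioi] at h0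
  have hlarge : ∀ R : ℝ, ∃ r > R, A ∩ closedBall ρ r = B ∩ closedBall ρ r := by
    intro R
    have : volume (Ioi (max R 0)) ≠ 0 := by simp
    obtain ⟨r, hr, hr0⟩ := ((frequently_ae_mem_iff.2 this).and_eventually h0).exists
    obtain ⟨hrR, hrpos⟩ := max_lt_iff.1 (mem_Ioi.1 hr)
    refine ⟨r, hrR, ?_⟩
    have h1 := hr0 hrpos
    have hexp : ENNReal.ofReal (Real.exp (-r)) ≠ 0 := by simp [Real.exp_pos]
    have hmin := (mul_eq_zero.1 h1).resolve_left hexp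
    rw [← (hA.inter isClosed_closedBall).hausdorffEDist_zero_iff
      (hB.inter isClosed_closedBall)]
    rcases min_choice (1 : ℝ≥0∞)
      (hausdorffEDist (A ∩ closedBall ρ r) (B ∩ closedBall ρ r)) with h' | h'
    · simp [h'] at hmin
    · rwa [h'] at hmin
  ext x
  obtain ⟨r, hr, hAB⟩ := hlarge (dist x ρ)
  have hx : x ∈ closedBall ρ r := hr.le
  simpa [hx] using Set.ext_iff.1 hAB x

theorem localHausdorffDist_triangle (ρ : X) {A B : Set X} (C : Set X) (hA : IsClosed A)
    (hB : IsClosed B) :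
    localHausdorffDist ρ A C ≤ localHausdorffDist ρ A B + localHausdorffDist ρ B C := by
  simp only [localHausdorffDist_def]
  rw [← lintegral_add_left (measurable_localHausdorffDist_integrand hA hB ρ)]
  refine lintegral_mono fun r => ?_
  simp only [← mul_add]
  gcongr
  refine (min_le_min_left 1 (hausdorffEDist_triangle (t := B ∩ closedBall ρ r))).trans ?_
  rcases le_total 1 (hausdorffEDist (A ∩ closedBall ρ r) (B ∩ closedBall ρ r)) with h | h
  · exact (min_le_left _ _).trans (by rw [min_eq_left h]; exact le_self_add)
  rcases le_total 1 (hausdorffEDist (B ∩ closedBall ρ r) (C ∩ closedBall ρ r)) with h' | h'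
  · exact (min_le_left _ _).trans (by rw [min_eq_left h']; exact le_add_self)
  rw [min_eq_right h, min_eq_right h']
  exact min_le_right _ _

/-- Convergence of closed sets in the sense of Kuratowski implies Hausdorff convergence of their
traces on every closed ball whose radius is not a local minimum value, along the limit, of the
distance to the centre. -/
theorem tendsto_hausdorffEDist_inter_closedBall (ρ : X) {B : ℕ → Set X} {L : Set X}
    (hL : IsClosed L) (h₁ : ∀ x ∈ L, Tendsto (fun k => infEDist x (B k)) atTop (𝓝 0))
    (h₂ : ∀ y ∉ L, ∃ δ > 0, ∀ᶠ k in atTop, δ ≤ infEDist y (B k)) {r : ℝ}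
    (hr : r ∉ (dist · ρ) '' {x | x ∈ L ∧ IsLocalMinOn (dist · ρ) L x}) :
    Tendsto (fun k => hausdorffEDist (B k ∩ closedBall ρ r) (L ∩ closedBall ρ r))
      atTop (𝓝 0) := by
  refine ENNReal.tendsto_nhds_zero.2 fun ε hε => ?_
  have hball := isCompact_closedBall ρ r
  have hup : ∀ᶠ k in atTop,
      ∀ y ∈ closedBall ρ r ∩ {y | ε ≤ infEDist y (L ∩ closedBall ρ r)}, y ∉ B k := by
    have hK : IsCompact (closedBall ρ r ∩ {y | ε ≤ infEDist y (L ∩ closedBall ρ r)}) :=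
      hball.inter_right (isClosed_le continuous_const continuous_infEDist)
    have := hK.mem_prod_nhdsSet_of_forall (l := atTop) (s := {p : ℕ × X | p.2 ∉ B p.1}) ?_
    · exact (Filter.Eventually.curry this).mono fun _ h => h.self_of_nhdsSet
    · rintro y ⟨hyr, hy⟩
      have hyL : y ∉ L := fun hyL => by
        have h0 := infEDist_zero_of_mem (mem_inter hyL hyr)
        exact hε.not_ge (h0 ▸ mem_ofPred.1 hy)
      obtain ⟨δ, hδ, hev⟩ := h₂ y hyL
      filter_upwards [hev.prod_mk (eball_mem_nhds y hδ)] with p hp hpB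
      exact absurd ((infEDist_le_edist_of_mem hpB).trans_lt
        (by rw [edist_comm]; exact hp.2)) (not_lt.2 hp.1)
  have hlow : ∀ᶠ k in atTop, ∀ x ∈ L ∩ closedBall ρ r,
      infEDist x (B k ∩ closedBall ρ r) < ε := by
    have := (hball.inter_left hL).mem_prod_nhdsSet_of_forall (l := atTop)
      (s := {p : ℕ × X | infEDist p.2 (B p.1 ∩ closedBall ρ r) < ε}) ?_
    · exact (Filter.Eventually.curry this).mono fun _ h => h.self_of_nhdsSet
    · rintro x ⟨hxL, hxr⟩
      have hε3 : 0 < ε / 3 := ENNReal.div_pos hε.ne' (by simp)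
      obtain ⟨x', hx'L, hx'r, hxx'⟩ :
          ∃ x' ∈ L, dist x' ρ < r ∧ edist x x' < ε / 3 := by
        rcases (mem_closedBall.1 hxr).lt_or_eq with hlt | heq
        · exact ⟨x, hxL, hlt, by simpa using hε3⟩
        · have hnot : ¬ IsLocalMinOn (dist · ρ) L x := fun hmin =>
            hr ⟨x, ⟨hxL, hmin⟩, heq⟩
          have hfr : ∃ᶠ z in 𝓝[L] x, ¬ dist x ρ ≤ dist z ρ :=
            not_eventually.1 hnot
          obtain ⟨x', hx', hx'x, hx'L⟩ := (hfr.and_eventually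
            (inter_mem (mem_nhdsWithin_of_mem_nhds (eball_mem_nhds x hε3))
              self_mem_nhdsWithin)).exists
          exact ⟨x', hx'L, heq ▸ not_le.1 hx', by rw [edist_comm]; exact hx'x⟩
      have hpos : 0 < min (ε / 3) (ENNReal.ofReal (r - dist x' ρ)) :=
        lt_min hε3 (ENNReal.ofReal_pos.2 (sub_pos.2 hx'r))
      filter_upwards [((h₁ x' hx'L).eventually (gt_mem_nhds hpos)).prod_mk
        (eball_mem_nhds x hε3)] with p hp
      obtain ⟨y, hyB, hy⟩ := infEDist_lt_iff.1 hp.1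
      obtain ⟨hyε, hyr⟩ := lt_min_iff.1 hy
      have hyball : y ∈ closedBall ρ r := by
        rw [edist_dist, ENNReal.ofReal_lt_ofReal_iff (sub_pos.2 hx'r)] at hyr
        have := dist_triangle_left y ρ x'
        exact mem_closedBall.2 (by linarith)
      calc infEDist p.2 (B p.1 ∩ closedBall ρ r) ≤ edist p.2 y :=
            infEDist_le_edist_of_mem ⟨hyB, hyball⟩
        _ ≤ edist p.2 x + edist x x' + edist x' y := edist_triangle4 _ _ _ _
        _ < ε / 3 + ε / 3 + ε / 3 :=
            ENNReal.add_lt_add (ENNReal.add_lt_add hp.2 hxx') hyε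
        _ = ε := ENNReal.add_thirds ε
  filter_upwards [hup, hlow] with k hk hk'
  refine hausdorffEDist_le_of_infEDist (fun y hy => ?_) fun x hx => (hk' x hx).le
  by_contra! hlt
  exact hk y ⟨hy.2, hlt.le⟩ hy.1

theorem tendsto_localHausdorffDist_zero (ρ : X) {B : ℕ → Set X} {L : Set X}
    (hB : ∀ k, IsClosed (B k)) (hL : IsClosed L)
    (h₁ : ∀ x ∈ L, Tendsto (fun k => infEDist x (B k)) atTop (𝓝 0))
    (h₂ : ∀ y ∉ L, ∃ δ > 0, ∀ᶠ k in atTop, δ ≤ infEDist y (B k)) :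
    Tendsto (fun k => localHausdorffDist ρ (B k) L) atTop (𝓝 0) := by
  have hlim := tendsto_lintegral_of_dominated_convergence (μ := volume.restrict (Ioi (0 : ℝ)))
    (f := 0) (fun r => ENNReal.ofReal (Real.exp (-r)))
    (fun k => measurable_localHausdorffDist_integrand (hB k) hL ρ)
    (fun k => ae_of_all _ fun r => mul_le_of_le_one_right' (min_le_left _ _))
    (integrableOn_exp_neg_Ioi 0).lintegral_lt_top.ne ?_
  · simpa [localHausdorffDist_def] using hlim
  · have hc := (countable_image_isLocalMinOn (dist · ρ) L).ae_notMem
      (volume.restrict (Ioi (0 : ℝ)))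
    filter_upwards [hc] with r hr
    have ht := tendsto_hausdorffEDist_inter_closedBall ρ hL h₁ h₂ hr
    have hmin : Tendsto (fun k => min 1
        (hausdorffEDist (B k ∩ closedBall ρ r) (L ∩ closedBall ρ r))) atTop (𝓝 0) :=
      tendsto_of_tendsto_of_tendsto_of_le_of_le tendsto_const_nhds ht (fun _ => zero_le)
        fun _ => min_le_right _ _
    simpa using ENNReal.Tendsto.const_mul hmin (Or.inr ENNReal.ofReal_ne_top)

end ProperSpace

theorem isClosed_setOf_tendsto_infEDist {X : Type*} [PseudoEMetricSpace X] (B : ℕ → Set X) :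
    IsClosed {x | Tendsto (fun k => infEDist x (B k)) atTop (𝓝 0)} := by
  refine isClosed_of_closure_subset fun x hx => ENNReal.tendsto_nhds_zero.2 fun ε hε => ?_
  have hε2 : 0 < ε / 2 := ENNReal.half_pos hε.ne'
  obtain ⟨y, hy, hxy⟩ := EMetric.mem_closure_iff.1 hx _ hε2
  filter_upwards [ENNReal.tendsto_nhds_zero.1 hy _ hε2] with k hk
  calc infEDist x (B k) ≤ infEDist y (B k) + edist x y := infEDist_le_infEDist_add_edist
    _ ≤ ε / 2 + ε / 2 := add_le_add hk hxy.le
    _ = ε := ENNReal.add_halves ε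

/-- Every sequence of sets in a separable space has a subsequence converging in the sense of
Kuratowski. -/
theorem exists_strictMono_kuratowski_limit {X : Type*} [PseudoEMetricSpace X]
    [TopologicalSpace.SeparableSpace X] [Nonempty X] (A : ℕ → Set X) :
    ∃ φ : ℕ → ℕ, StrictMono φ ∧ ∃ L : Set X, IsClosed L ∧
      (∀ x ∈ L, Tendsto (fun k => infEDist x (A (φ k))) atTop (𝓝 0)) ∧
      ∀ y ∉ L, ∃ δ > 0, ∀ᶠ k in atTop, δ ≤ infEDist y (A (φ k)) := by
  let q := TopologicalSpace.denseSeq X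
  obtain ⟨a, φ, hφ, ha⟩ := CompactSpace.tendsto_subseq
    fun n => fun i : ℕ => infEDist (q i) (A n)
  refine ⟨φ, hφ, _, isClosed_setOf_tendsto_infEDist fun k => A (φ k), fun x hx => hx, ?_⟩
  intro y hy
  contrapose! hy
  refine ENNReal.tendsto_nhds_zero.2 fun ε hε => ?_
  have hε4 : 0 < ε / 2 / 2 := ENNReal.half_pos (ENNReal.half_pos hε.ne').ne'
  obtain ⟨_, ⟨i, rfl⟩, hi⟩ :=
    EMetric.mem_closure_iff.1 (TopologicalSpace.denseRange_denseSeq X y) _ hε4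
  have hlim : Tendsto (fun k => infEDist (q i) (A (φ k))) atTop (𝓝 (a i)) :=
    (tendsto_pi_nhds.1 ha) i
  rcases eq_or_ne ε ⊤ with rfl | hεtop
  · simp
  have hai : a i ≤ ε / 2 := by
    by_contra! hlt
    obtain ⟨k, hk, hk'⟩ :=
      ((hy _ hε4).and_eventually (hlim.eventually (lt_mem_nhds hlt))).exists
    refine hk'.not_ge ?_
    calc infEDist (q i) (A (φ k)) ≤ edist (q i) y + infEDist y (A (φ k)) :=
          infEDist_le_edist_add_infEDist
      _ ≤ ε / 2 / 2 + ε / 2 / 2 := add_le_add (by rw [edist_comm]; exact hi.le) hk.le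
      _ = ε / 2 := ENNReal.add_halves _
  have hai' : a i < ε / 2 + ε / 2 / 2 :=
    hai.trans_lt (ENNReal.lt_add_right (ENNReal.div_ne_top hεtop (by simp)) hε4.ne')
  filter_upwards [hlim.eventually (gt_mem_nhds hai')] with k hk
  calc infEDist y (A (φ k)) ≤ infEDist (q i) (A (φ k)) + edist y (q i) :=
        infEDist_le_infEDist_add_edist
    _ ≤ (ε / 2 + ε / 2 / 2) + ε / 2 / 2 := add_le_add hk.le hi.le
    _ = ε := by rw [add_assoc, ENNReal.add_halves, ENNReal.add_halves]

theorem exists_finite_subset_range_kuratowski_limit {X : Type*} [PseudoEMetricSpace X]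
    [SecondCountableTopology X] {q : ℕ → X} (hq : DenseRange q) {A : Set X} (hA : IsClosed A) :
    ∃ F : ℕ → Set X, (∀ n, (F n).Finite ∧ F n ⊆ range q) ∧
      (∀ x ∈ A, Tendsto (fun k => infEDist x (F k)) atTop (𝓝 0)) ∧
      ∀ y ∉ A, ∃ δ > 0, ∀ᶠ k in atTop, δ ≤ infEDist y (F k) := by
  rcases A.eq_empty_or_nonempty with rfl | hne
  · exact ⟨fun _ => ∅, by simp, by simp, fun y _ => ⟨1, one_pos, by simp⟩⟩
  have : Nonempty A := hne.to_subtype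
  let a := TopologicalSpace.denseSeq A
  have hex : ∀ n i : ℕ, ∃ j, edist (a i : X) (q j) < ((n : ℝ≥0∞) + 1)⁻¹ := by
    intro n i
    obtain ⟨_, ⟨j, rfl⟩, hj⟩ := EMetric.mem_closure_iff.1 (hq (a i : X))
      ((n : ℝ≥0∞) + 1)⁻¹ (by simp)
    exact ⟨j, hj⟩
  choose j hj using hex
  have hsmall : Tendsto (fun n : ℕ => ((n : ℝ≥0∞) + 1)⁻¹) atTop (𝓝 0) := by
    simpa [Function.comp_def] using
      ENNReal.tendsto_inv_nat_nhds_zero.comp (tendsto_add_atTop_nat 1)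
  refine ⟨fun n => (fun i => q (j n i)) '' Iio n, fun n => ⟨(finite_Iio n).image _, ?_⟩, ?_, ?_⟩
  · rintro _ ⟨i, -, rfl⟩
    exact mem_range_self _
  · have hrange : ∀ i, Tendsto (fun n => infEDist (a i : X) ((fun i => q (j n i)) '' Iio n))
        atTop (𝓝 0) := by
      intro i
      refine tendsto_of_tendsto_of_tendsto_of_le_of_le' tendsto_const_nhds hsmall
        (Eventually.of_forall fun _ => zero_le) ?_
      filter_upwards [eventually_gt_atTop i] with n hn
      exact (infEDist_le_edist_of_mem (mem_image_of_mem _ (mem_Iio.2 hn))).trans (hj n i).le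
    intro x hx
    have hcl := (isClosed_setOf_tendsto_infEDist
      fun n => (fun i => q (j n i)) '' Iio n).preimage (continuous_subtype_val (p := (· ∈ A)))
    exact (TopologicalSpace.denseRange_denseSeq A).induction_on
      (p := fun x => Tendsto (fun n => infEDist (x : X) ((fun i => q (j n i)) '' Iio n))
        atTop (𝓝 0)) ⟨x, hx⟩ hcl hrange
  · intro y hy
    have hpos : 0 < infEDist y A := by
      rwa [infEDist_pos_iff_notMem_closure, hA.closure_eq]
    obtain ⟨η, hη, hηy⟩ := exists_between hpos
    obtain ⟨δ, hδ, hδη⟩ := exists_between hη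
    refine ⟨η - δ, tsub_pos_of_lt hδη, ?_⟩
    filter_upwards [hsmall.eventually (gt_mem_nhds hδ)] with n hn
    refine le_iInf₂ ?_
    rintro _ ⟨i, -, rfl⟩
    rw [tsub_le_iff_right]
    calc η ≤ infEDist y A := hηy.le
      _ ≤ edist y (a i) := infEDist_le_edist_of_mem (a i).2
      _ ≤ edist y (q (j n i)) + edist (a i : X) (q (j n i)) := edist_triangle_right _ _ _
      _ ≤ edist y (q (j n i)) + δ := by gcongr; exact ((hj n i).trans hn).le

/-- **The local Hausdorff distance is a complete separable metric on the closed subsets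
of a proper metric space**: it is symmetric, vanishes exactly on equal pairs, satisfies
the triangle inequality, is complete, and is separable. -/
theorem localHausdorffDist_metric_complete_separable
    {X : Type*} [MetricSpace X] [ProperSpace X] (ρ : X) :
    (∀ A B : Set X, IsClosed A → IsClosed B →
        localHausdorffDist ρ A B = localHausdorffDist ρ B A) ∧
    (∀ A B : Set X, IsClosed A → IsClosed B →
        (localHausdorffDist ρ A B = 0 ↔ A = B)) ∧
    (∀ A B C : Set X, IsClosed A → IsClosed B → IsClosed C →
        localHausdorffDist ρ A C ≤ localHausdorffDist ρ A B + localHausdorffDist ρ B C) ∧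
    (∀ A : ℕ → Set X, (∀ n, IsClosed (A n)) →
        (∀ ε : ℝ≥0∞, 0 < ε → ∃ N : ℕ, ∀ m ≥ N, ∀ n ≥ N,
          localHausdorffDist ρ (A m) (A n) < ε) →
        ∃ L : Set X, IsClosed L ∧
          Tendsto (fun n => localHausdorffDist ρ (A n) L) atTop (𝓝 0)) ∧
    (∃ 𝒟 : Set (Set X), 𝒟.Countable ∧ (∀ B ∈ 𝒟, IsClosed B) ∧
        ∀ A : Set X, IsClosed A → ∀ ε : ℝ≥0∞, 0 < ε →
          ∃ B ∈ 𝒟, localHausdorffDist ρ A B < ε) := by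
  have : Nonempty X := ⟨ρ⟩
  refine ⟨fun A B _ _ => localHausdorffDist_comm ρ A B,
    fun A B hA hB => localHausdorffDist_eq_zero_iff ρ hA hB,
    fun A B C hA hB _ => localHausdorffDist_triangle ρ C hA hB, ?_, ?_⟩
  · intro A hA hcau
    obtain ⟨φ, hφ, L, hL, h₁, h₂⟩ := exists_strictMono_kuratowski_limit A
    have hsub := tendsto_localHausdorffDist_zero ρ (fun k => hA (φ k)) hL h₁ h₂
    refine ⟨L, hL, ENNReal.tendsto_nhds_zero.2 fun ε hε => ?_⟩
    have hε2 : 0 < ε / 2 := ENNReal.half_pos hε.ne'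
    obtain ⟨N, hN⟩ := hcau _ hε2
    obtain ⟨k, hk, hkN⟩ := ((ENNReal.tendsto_nhds_zero.1 hsub _ hε2).and
      (hφ.tendsto_atTop.eventually_ge_atTop N)).exists
    filter_upwards [eventually_ge_atTop N] with n hn
    calc localHausdorffDist ρ (A n) L
        ≤ localHausdorffDist ρ (A n) (A (φ k)) + localHausdorffDist ρ (A (φ k)) L :=
          localHausdorffDist_triangle ρ L (hA n) (hA (φ k))
      _ ≤ ε / 2 + ε / 2 := add_le_add (hN n hn _ hkN).le hk
      _ = ε := ENNReal.add_halves ε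
  · refine ⟨{F | F.Finite ∧ F ⊆ range (TopologicalSpace.denseSeq X)},
      countable_ofPred_finite_subset (countable_range _), fun B hB => hB.1.isClosed, ?_⟩
    intro A hA ε hε
    obtain ⟨F, hF, h₁, h₂⟩ := exists_finite_subset_range_kuratowski_limit
      (TopologicalSpace.denseRange_denseSeq X) hA
    have hlim := tendsto_localHausdorffDist_zero ρ (fun k => (hF k).1.isClosed) hA h₁ h₂
    obtain ⟨k, hk⟩ := (hlim.eventually (gt_mem_nhds hε)).exists
    exact ⟨F k, hF k, by rwa [localHausdorffDist_comm]⟩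
end

section
/- Let X, Y, M₁, M₂ be metric spaces equipped with their Borel σ-algebras, let f₁ : X → M₁, f₂ : X → M₂, g₁ : Y → M₁, g₂ : Y → M₂ be isometric embeddings, and let ε ≥ 0 satisfy dist(f₂(x), g₂(y)) ≤ dist(f₁(x), g₁(y)) + ε for all x ∈ X, y ∈ Y. Then for every finite Borel measure μ on X and every finite Borel measure ν on Y, the Lévy–Prokhorov distances of the pushforward measures satisfy dLP((f₂)_*μ, (g₂)_*ν) ≤ dLP((f₁)_*μ, (g₁)_*ν) + ε. -/
open MeasureTheory

/-- One half of the Lévy–Prokhorov condition for the pushforwards along `f₂` and `g₂`. -/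
lemma map_le_map_thickening_add_of_levyProkhorovEDist_lt
    {X Y M₁ M₂ : Type*} [MeasurableSpace X] [MeasurableSpace Y]
    [PseudoMetricSpace M₁] [MeasurableSpace M₁] [BorelSpace M₁]
    [PseudoMetricSpace M₂] [MeasurableSpace M₂] [BorelSpace M₂]
    {f₁ : X → M₁} {f₂ : X → M₂} {g₁ : Y → M₁} {g₂ : Y → M₂}
    (hf₁ : Measurable f₁) (hf₂ : Measurable f₂) (hg₁ : Measurable g₁) (hg₂ : Measurable g₂)
    {ε : ℝ} (hε : 0 ≤ ε)
    (h : ∀ (x : X) (y : Y), dist (f₂ x) (g₂ y) ≤ dist (f₁ x) (g₁ y) + ε)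
    {μ : Measure X} {ν : Measure Y} {c : ENNReal} (hc : c ≠ ⊤)
    (hlt : levyProkhorovEDist (μ.map f₁) (ν.map g₁) < c) {B : Set M₂} (hB : MeasurableSet B) :
    μ.map f₂ B ≤ ν.map g₂ (Metric.thickening (c + ENNReal.ofReal ε).toReal B) +
      (c + ENNReal.ofReal ε) := by
  -- The image of a Borel set need not be Borel, so pass to its closure.
  set C := closure (f₁ '' (f₂ ⁻¹' B)) with hC
  have hCm : MeasurableSet C := isClosed_closure.measurableSet
  have key := left_measure_le_of_levyProkhorovEDist_lt hlt hCm
  rw [Measure.map_apply hf₁ hCm, hC, Metric.thickening_closure,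
    Measure.map_apply hg₁ Metric.isOpen_thickening.measurableSet] at key
  rw [Measure.map_apply hf₂ hB, Measure.map_apply hg₂ Metric.isOpen_thickening.measurableSet]
  calc μ (f₂ ⁻¹' B) ≤ μ (f₁ ⁻¹' closure (f₁ '' (f₂ ⁻¹' B))) :=
        measure_mono fun x hx ↦ subset_closure (Set.mem_image_of_mem f₁ hx)
    _ ≤ _ := key
    _ ≤ _ := by
      refine add_le_add (measure_mono fun y hy ↦ ?_) le_self_add
      obtain ⟨_, ⟨x, hx, rfl⟩, hxy⟩ := Metric.mem_thickening_iff.mp hy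
      refine Metric.mem_thickening_iff.mpr ⟨f₂ x, hx, ?_⟩
      rw [ENNReal.toReal_add hc ENNReal.ofReal_ne_top, ENNReal.toReal_ofReal hε, dist_comm]
      rw [dist_comm] at hxy
      linarith [h x y]

/-- The extended-distance version of `levyProkhorovDist_map_le_of_dist_le`, for measurable maps. -/
lemma levyProkhorovEDist_map_le_of_dist_le
    {X Y M₁ M₂ : Type*} [MeasurableSpace X] [MeasurableSpace Y]
    [PseudoMetricSpace M₁] [MeasurableSpace M₁] [BorelSpace M₁]
    [PseudoMetricSpace M₂] [MeasurableSpace M₂] [BorelSpace M₂]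
    {f₁ : X → M₁} {f₂ : X → M₂} {g₁ : Y → M₁} {g₂ : Y → M₂}
    (hf₁ : Measurable f₁) (hf₂ : Measurable f₂) (hg₁ : Measurable g₁) (hg₂ : Measurable g₂)
    {ε : ℝ} (hε : 0 ≤ ε)
    (h : ∀ (x : X) (y : Y), dist (f₂ x) (g₂ y) ≤ dist (f₁ x) (g₁ y) + ε)
    (μ : Measure X) (ν : Measure Y) :
    levyProkhorovEDist (μ.map f₂) (ν.map g₂) ≤
      levyProkhorovEDist (μ.map f₁) (ν.map g₁) + ENNReal.ofReal ε := by
  rcases eq_or_ne (levyProkhorovEDist (μ.map f₁) (ν.map g₁)) ⊤ with htop | htop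
  · simp [htop]
  refine levyProkhorovEDist_le_of_forall_add_pos_le _ _ _ fun δ B hδ hδ_top hB ↦ ?_
  have hlt := ENNReal.lt_add_right htop hδ.ne'
  have hc := ENNReal.add_ne_top.mpr ⟨htop, hδ_top.ne⟩
  have h' : ∀ (y : Y) (x : X), dist (g₂ y) (f₂ x) ≤ dist (g₁ y) (f₁ x) + ε := fun y x ↦ by
    simpa only [dist_comm] using h x y
  have h₁ := map_le_map_thickening_add_of_levyProkhorovEDist_lt hf₁ hf₂ hg₁ hg₂ hε h hc hlt hB
  have h₂ := map_le_map_thickening_add_of_levyProkhorovEDist_lt hg₁ hg₂ hf₁ hf₂ hε h' hc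
    ((levyProkhorovEDist_comm _ _).trans_lt hlt) hB
  simpa only [add_assoc, add_comm δ (ENNReal.ofReal ε)] using And.intro h₁ h₂

/-- **Stability of the Lévy–Prokhorov distance under ε-deformations of the ambient
space.** If `f₁, f₂, g₁, g₂` are isometric embeddings with
`dist (f₂ x) (g₂ y) ≤ dist (f₁ x) (g₁ y) + ε` for all `x, y`, then for finite Borel
measures `μ` on `X` and `ν` on `Y`, the Lévy–Prokhorov distances of the pushforwards
satisfy `dLP ((f₂)_*μ) ((g₂)_*ν) ≤ dLP ((f₁)_*μ) ((g₁)_*ν) + ε`. -/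
theorem levyProkhorovDist_map_le_of_dist_le
    {X Y M₁ M₂ : Type*}
    [MetricSpace X] [MeasurableSpace X] [BorelSpace X]
    [MetricSpace Y] [MeasurableSpace Y] [BorelSpace Y]
    [MetricSpace M₁] [MeasurableSpace M₁] [BorelSpace M₁]
    [MetricSpace M₂] [MeasurableSpace M₂] [BorelSpace M₂]
    {f₁ : X → M₁} {f₂ : X → M₂} {g₁ : Y → M₁} {g₂ : Y → M₂}
    (hf₁ : Isometry f₁) (hf₂ : Isometry f₂) (hg₁ : Isometry g₁) (hg₂ : Isometry g₂)
    {ε : ℝ} (hε : 0 ≤ ε)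
    (h : ∀ (x : X) (y : Y), dist (f₂ x) (g₂ y) ≤ dist (f₁ x) (g₁ y) + ε)
    (μ : Measure X) [IsFiniteMeasure μ] (ν : Measure Y) [IsFiniteMeasure ν] :
    levyProkhorovDist (μ.map f₂) (ν.map g₂) ≤ levyProkhorovDist (μ.map f₁) (ν.map g₁) + ε := by
  have key := levyProkhorovEDist_map_le_of_dist_le hf₁.continuous.measurable
    hf₂.continuous.measurable hg₁.continuous.measurable hg₂.continuous.measurable hε h μ ν
  have htop := levyProkhorovEDist_ne_top (μ.map f₁) (ν.map g₁)
  have := ENNReal.toReal_mono (ENNReal.add_ne_top.mpr ⟨htop, ENNReal.ofReal_ne_top⟩) key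
  rwa [ENNReal.toReal_add htop ENNReal.ofReal_ne_top, ENNReal.toReal_ofReal hε] at this
end

section
/- Let X be a proper metric space equipped with its Borel σ-algebra and let ρ ∈ X. For Borel measures μ, ν on X that are finite on compact sets (Radon measures), define V_ρ(μ,ν) := ∫_{(0,∞)} e^{−r} · min(1, dLPe(μ|B̄(ρ,r), ν|B̄(ρ,r))) dr. Then: (a) V_ρ(μ,ν) = V_ρ(ν,μ); (b) V_ρ(μ,ν) = 0 if and only if μ = ν; (c) V_ρ(μ,ξ) ≤ V_ρ(μ,ν) + V_ρ(ν,ξ); (d) V_ρ is complete: for every sequence (μ_n) of Borel measures finite on compact sets such that for every ε > 0 there is N with V_ρ(μ_m, μ_n) < ε for all m, n ≥ N, there exists a Borel measure μ finite on compact sets with V_ρ(μ_n, μ) → 0; (e) V_ρ is separable: there is a countable family 𝒟 of Borel measures finite on compact sets such that for every such measure μ and every ε > 0 some ν ∈ 𝒟 has V_ρ(μ,ν) < ε. -/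
open Metric Set MeasureTheory Filter
open scoped ENNReal Topology

/-- The vague metric with basepoint `ρ` between Borel measures on a metric space:
`V_ρ(μ,ν) := ∫_{(0,∞)} e^{-r} · min(1, dLPe(μ|B̄(ρ,r), ν|B̄(ρ,r))) dr`,
with values in `ℝ≥0∞`, where `dLPe` is the `ℝ≥0∞`-valued Lévy–Prokhorov distance. -/
noncomputable def vagueDist {X : Type*} [PseudoMetricSpace X] [MeasurableSpace X] (ρ : X)
    (μ ν : Measure X) : ℝ≥0∞ :=
  ∫⁻ r in Set.Ioi (0 : ℝ),
    ENNReal.ofReal (Real.exp (-r)) *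
      min 1 (levyProkhorovEDist (μ.restrict (Metric.closedBall ρ r))
        (ν.restrict (Metric.closedBall ρ r)))

open scoped NNReal CompactlySupported

section VagueDist

variable {X : Type*}

theorem levyProkhorovEDist_restrict_le [PseudoEMetricSpace X] [MeasurableSpace X]
    (μ : Measure X) {A B : Set X} (hAB : A ⊆ B) (hA : MeasurableSet A) :
    levyProkhorovEDist (μ.restrict A) (μ.restrict B) ≤ μ (B \ A) := by
  refine levyProkhorovEDist_le_of_forall _ _ _ fun ε S hε hεt hS ↦ ?_
  have hpos : 0 < ε.toReal := ENNReal.toReal_pos (zero_le.trans_lt hε).ne' hεt.ne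
  constructor
  · exact (Measure.restrict_mono_set μ hAB S).trans
      (le_add_right (measure_mono (self_subset_thickening hpos S)))
  · calc μ.restrict B S = μ (S ∩ B) := Measure.restrict_apply hS
      _ ≤ μ (S ∩ A ∪ B \ A) := measure_mono fun x hx ↦ by
          by_cases h : x ∈ A
          · exact Or.inl ⟨hx.1, h⟩
          · exact Or.inr ⟨hx.2, h⟩
      _ ≤ μ (S ∩ A) + μ (B \ A) := measure_union_le _ _
      _ ≤ μ.restrict A (thickening ε.toReal S) + ε := by
          rw [← Measure.restrict_apply' hA]
          exact add_le_add (measure_mono (self_subset_thickening hpos S)) hε.le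

theorem vagueDist_comm [PseudoMetricSpace X] [MeasurableSpace X] (ρ : X) (μ ν : Measure X) :
    vagueDist ρ μ ν = vagueDist ρ ν μ := by
  simp only [vagueDist, levyProkhorovEDist_comm]

theorem vagueDist_self [PseudoMetricSpace X] [MeasurableSpace X] (ρ : X) (μ : Measure X) :
    vagueDist ρ μ μ = 0 := by
  simp [vagueDist]

theorem isFiniteMeasure_restrict_closedBall [PseudoMetricSpace X] [ProperSpace X]
    [MeasurableSpace X] (μ : Measure X) [IsFiniteMeasureOnCompacts μ] (ρ : X) (r : ℝ) :
    IsFiniteMeasure (μ.restrict (closedBall ρ r)) :=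
  isFiniteMeasure_restrict.2 (isCompact_closedBall ρ r).measure_lt_top.ne

theorem eq_of_levyProkhorovEDist_eq_zero [PseudoEMetricSpace X] [MeasurableSpace X]
    [BorelSpace X] {μ ν : Measure X} [IsFiniteMeasure μ] [IsFiniteMeasure ν]
    (h : levyProkhorovEDist μ ν = 0) : μ = ν := by
  have hcl (s : Set X) (hs : IsClosed s) : μ s = ν s :=
    measure_eq_measure_of_levyProkhorovEDist_eq_zero_of_isClosed h hs
      ⟨1, one_pos, measure_ne_top _ _⟩ ⟨1, one_pos, measure_ne_top _ _⟩
  exact ext_of_generate_finite {s : Set X | IsClosed s}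
    (BorelSpace.measurable_eq.trans borel_eq_generateFrom_isClosed)
    isPiSystem_isClosed hcl (hcl univ isClosed_univ)

theorem exists_ball_cutoff [PseudoMetricSpace X] [ProperSpace X] (ρ : X) (R : ℝ)
    {δ : ℝ} (hδ : 0 < δ) :
    ∃ f : C_c(X, ℝ≥0), (∀ x, f x ≤ 1) ∧ (∀ x ∈ closedBall ρ R, f x = 1) ∧
      ∀ x ∉ closedBall ρ (R + δ), f x = 0 := by
  have hcont : Continuous fun x ↦ Real.toNNReal (min 1 ((R + δ - dist x ρ) / δ)) := by fun_prop
  have hzero (x : X) (hx : x ∉ closedBall ρ (R + δ)) :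
      Real.toNNReal (min 1 ((R + δ - dist x ρ) / δ)) = 0 := by
    rw [mem_closedBall, not_le] at hx
    exact Real.toNNReal_of_nonpos <|
      (min_le_right _ _).trans (div_nonpos_of_nonpos_of_nonneg (by linarith) hδ.le)
  refine ⟨⟨⟨_, hcont⟩, HasCompactSupport.intro (isCompact_closedBall ρ (R + δ)) hzero⟩, ?_, ?_,
    hzero⟩
  · exact fun x ↦ Real.toNNReal_le_one.2 (min_le_left _ _)
  · intro x hx
    rw [mem_closedBall] at hx
    change Real.toNNReal (min 1 ((R + δ - dist x ρ) / δ)) = 1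
    rw [min_eq_left ((one_le_div hδ).2 (by linarith)), Real.toNNReal_one]

theorem lintegral_compactlySupported_ne_top [TopologicalSpace X] [MeasurableSpace X]
    [OpensMeasurableSpace X] (μ : Measure X) [IsFiniteMeasureOnCompacts μ] (f : C_c(X, ℝ≥0)) :
    ∫⁻ x, f x ∂μ ≠ ⊤ := by
  have h : Integrable (fun x ↦ (f x : ℝ)) μ :=
    (NNReal.continuous_coe.comp (map_continuous f)).integrable_of_hasCompactSupport
      (f.hasCompactSupport.comp_left NNReal.coe_zero)
  have h' := h.2.ne
  simpa [HasFiniteIntegral, enorm_eq_self] using h'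

theorem exists_fine_partition [MetricSpace X] [ProperSpace X] {K : Set X} (hK : IsCompact K)
    {δ : ℝ} (hδ : 0 < δ) :
    ∃ (t : Set X) (_ : Fintype t) (φ : t → C_c(X, ℝ≥0)),
      (∀ x ∈ K, ∑ i, φ i x = 1) ∧ (∀ x, ∑ i, φ i x ≤ 1) ∧
      (∀ i x, φ i x ≠ 0 → x ∈ thickening δ K) ∧
      ∀ i x y, φ i x ≠ 0 → φ i y ≠ 0 → dist x y < δ := by
  obtain ⟨t, htK, htf, hKt⟩ := hK.finite_cover_balls (half_pos hδ)
  have := htf.fintype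
  obtain ⟨f, hf, hfc⟩ := PartitionOfUnity.exists_isSubordinate_of_locallyFinite_t2space hK
    (fun i : t ↦ ball (i : X) (δ / 2)) (fun _ ↦ isOpen_ball) (locallyFinite_of_finite _)
    (by simpa [iUnion_subtype] using hKt)
  have hball (i : t) (x : X) (hx : (f i x).toNNReal ≠ 0) : dist x i < δ / 2 :=
    hf i (subset_tsupport _ fun h ↦ hx (by simp [h]))
  have hsum (x : X) : ((∑ i, (f i x).toNNReal : ℝ≥0) : ℝ) = ∑ᶠ i, f i x := by
    rw [finsum_eq_sum_of_fintype, NNReal.coe_sum]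
    exact Finset.sum_congr rfl fun i _ ↦ Real.coe_toNNReal _ (f.nonneg i x)
  refine ⟨t, this, fun i ↦ ⟨⟨fun x ↦ (f i x).toNNReal, by fun_prop⟩,
    (hfc i).comp_left Real.toNNReal_zero⟩, fun x hx ↦ ?_, fun x ↦ ?_, fun i x hx ↦ ?_,
    fun i x y hx hy ↦ ?_⟩
  · exact NNReal.coe_injective ((hsum x).trans (f.sum_eq_one hx))
  · exact NNReal.coe_le_coe.1 ((hsum x).trans_le (f.sum_le_one x))
  · exact mem_thickening_iff.2 ⟨i, htK i.2, (hball i x hx).trans (half_lt_self hδ)⟩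
  · have := hball i x hx
    have := hball i y hy
    have := dist_triangle_right x y (i : X)
    linarith

theorem lintegral_le_of_levyProkhorovEDist_lt [PseudoMetricSpace X] [MeasurableSpace X]
    [OpensMeasurableSpace X] {α β : Measure X} {f : X → ℝ≥0} (hf : Measurable f)
    {M η c : ℝ≥0} (hM : ∀ x, f x ≤ M) (hc : ∀ x y, dist x y < c → f x ≤ f y + η)
    (h : levyProkhorovEDist α β < c) :
    ∫⁻ x, f x ∂α ≤ ∫⁻ x, f x ∂β + (η * β univ + c * M) := by
  have layer (κ : Measure X) {g : X → ℝ≥0} (hg : Measurable g) :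
      ∫⁻ x, g x ∂κ = ∫⁻ t in Ioi (0 : ℝ), κ {x | t ≤ g x} := by
    rw [← lintegral_eq_lintegral_meas_le κ (f := fun x ↦ (g x : ℝ))
      (ae_of_all _ fun x ↦ (g x).coe_nonneg) hg.coe_nnreal_real.aemeasurable]
    simp only [ENNReal.ofReal_coe_nnreal]
  have hlevel (t : ℝ) : α {x | t ≤ f x} ≤
      β {x | t ≤ (f x + η : ℝ≥0)} + (Iic (M : ℝ)).indicator (fun _ ↦ (c : ℝ≥0∞)) t := by
    by_cases ht : t ≤ M
    · rw [indicator_of_mem (mem_Iic.2 ht)]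
      refine (left_measure_le_of_levyProkhorovEDist_lt h
        (measurableSet_le measurable_const hf.coe_nnreal_real)).trans
        (add_le_add (measure_mono fun x hx ↦ ?_) le_rfl)
      obtain ⟨y, hy, hxy⟩ := mem_thickening_iff.1 hx
      rw [dist_comm] at hxy
      exact le_trans (mem_ofPred.1 hy) (NNReal.coe_le_coe.2 (hc y x (by simpa using hxy)))
    · have hempty : {x | t ≤ f x} = ∅ := eq_empty_of_forall_notMem fun x hx ↦
        ht (le_trans (mem_ofPred.1 hx) (NNReal.coe_le_coe.2 (hM x)))
      simp [hempty]
  calc ∫⁻ x, f x ∂α = ∫⁻ t in Ioi (0 : ℝ), α {x | t ≤ f x} := layer α hf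
    _ ≤ ∫⁻ t in Ioi (0 : ℝ), (β {x | t ≤ (f x + η : ℝ≥0)} +
          (Iic (M : ℝ)).indicator (fun _ ↦ (c : ℝ≥0∞)) t) := lintegral_mono hlevel
    _ = ∫⁻ x, (f x + η : ℝ≥0) ∂β + c * M := by
        rw [lintegral_add_right _ (measurable_const.indicator measurableSet_Iic),
          ← layer β (hf.add_const η), lintegral_indicator_const measurableSet_Iic,
          Measure.restrict_apply measurableSet_Iic, Iic_inter_Ioi, Real.volume_Ioc, sub_zero,
          ENNReal.ofReal_coe_nnreal]
    _ = ∫⁻ x, f x ∂β + (η * β univ + c * M) := by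
        simp only [ENNReal.coe_add]
        rw [lintegral_add_right _ measurable_const, lintegral_const, add_assoc]

theorem exists_levyProkhorovEDist_lt_of_vagueDist_lt [PseudoMetricSpace X] [MeasurableSpace X]
    (ρ : X) {μ ν : Measure X} {R : ℝ} (hR : 0 ≤ R) {c : ℝ≥0∞} (hc : c ≤ 1)
    (h : vagueDist ρ μ ν < ENNReal.ofReal (Real.exp (-(R + 1))) * c) :
    ∃ r ∈ Ioc R (R + 1),
      levyProkhorovEDist (μ.restrict (closedBall ρ r)) (ν.restrict (closedBall ρ r)) < c := by
  by_contra! hcon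
  refine h.not_ge ?_
  calc ENNReal.ofReal (Real.exp (-(R + 1))) * c
      = ∫⁻ _ in Ioc R (R + 1), ENNReal.ofReal (Real.exp (-(R + 1))) * c := by simp
    _ ≤ ∫⁻ r in Ioc R (R + 1), ENNReal.ofReal (Real.exp (-r)) *
          min 1 (levyProkhorovEDist (μ.restrict (closedBall ρ r))
            (ν.restrict (closedBall ρ r))) := by
        refine setLIntegral_mono' measurableSet_Ioc fun r hr ↦ ?_
        gcongr
        · exact hr.2
        · exact le_min hc (hcon r hr)
    _ ≤ vagueDist ρ μ ν := lintegral_mono_set fun r hr ↦ hR.trans_lt hr.1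

theorem restrict_le_restrict_thickening_add [PseudoMetricSpace X] [MeasurableSpace X]
    {ι : Type*} [Fintype ι] {φ : ι → X → ℝ≥0}
    (hφ : ∀ i, Measurable (φ i)) {K L : Set X} (hK : MeasurableSet K) {δ : ℝ}
    (hKφ : ∀ x ∈ K, ∑ i, φ i x = 1) (hφ1 : ∀ x, ∑ i, φ i x ≤ 1)
    (hφL : ∀ i x, φ i x ≠ 0 → x ∈ L) (hφδ : ∀ i x y, φ i x ≠ 0 → φ i y ≠ 0 → dist x y < δ)
    {α β : Measure X} {η : ℝ≥0∞} (hη : ∑ i, (∫⁻ x, φ i x ∂α - ∫⁻ x, φ i x ∂β) ≤ η)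
    {B : Set X} (hB : MeasurableSet B) :
    α.restrict K B ≤ β.restrict K (thickening δ B) + (β (L \ K) + η) := by
  classical
  set I : Finset ι := {i | ∃ x ∈ B, φ i x ≠ 0} with hI
  have h1 : α.restrict K B ≤ ∑ i ∈ I, ∫⁻ x, φ i x ∂α := by
    rw [Measure.restrict_apply hB, ← lintegral_finsetSum _ fun i _ ↦ (hφ i).coe_nnreal_ennreal,
      ← lintegral_indicator_one (hB.inter hK)]
    refine lintegral_mono fun x ↦ ?_
    by_cases hx : x ∈ B ∩ K
    · have hs : ∑ i ∈ I, φ i x = 1 := by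
        rw [← hKφ x hx.2]
        refine Finset.sum_subset (Finset.subset_univ _) fun i _ hi ↦ ?_
        by_contra hne
        exact hi (by simpa [hI] using ⟨x, hx.1, hne⟩)
      rw [indicator_of_mem hx, Pi.one_apply]
      rw [← ENNReal.ofNNReal_finsetSum]
      exact ENNReal.one_le_coe_iff.2 hs.ge
    · simp [hx]
  have h2 : ∑ i ∈ I, ∫⁻ x, φ i x ∂β ≤ β (thickening δ B ∩ L) := by
    rw [← lintegral_finsetSum _ fun i _ ↦ (hφ i).coe_nnreal_ennreal]
    refine le_trans ?_ (lintegral_indicator_one_le (thickening δ B ∩ L))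
    refine lintegral_mono fun x ↦ ?_
    by_cases hx : x ∈ thickening δ B ∩ L
    · rw [indicator_of_mem hx, Pi.one_apply]
      have hs : ∑ i ∈ I, φ i x ≤ 1 :=
        (Finset.sum_le_univ_sum_of_nonneg fun _ ↦ zero_le).trans (hφ1 x)
      rw [← ENNReal.ofNNReal_finsetSum]
      exact ENNReal.coe_le_one_iff.2 hs
    · rw [indicator_of_notMem hx]
      refine (Finset.sum_eq_zero fun i hi ↦ ?_).le
      obtain ⟨y, hyB, hy⟩ : ∃ y ∈ B, φ i y ≠ 0 := by simpa [hI] using hi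
      by_contra hne
      have hne' : φ i x ≠ 0 := by simpa using hne
      exact hx ⟨mem_thickening_iff.2 ⟨y, hyB, hφδ i x y hne' hy⟩, hφL i x hne'⟩
  have h3 : β (thickening δ B ∩ L) ≤ β.restrict K (thickening δ B) + β (L \ K) := by
    rw [Measure.restrict_apply' hK]
    refine (measure_mono fun x hx ↦ ?_).trans (measure_union_le _ _)
    by_cases h : x ∈ K
    · exact Or.inl ⟨hx.1, h⟩
    · exact Or.inr ⟨hx.2, h⟩
  calc α.restrict K B ≤ ∑ i ∈ I, ∫⁻ x, φ i x ∂α := h1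
    _ ≤ ∑ i ∈ I, (∫⁻ x, φ i x ∂β + (∫⁻ x, φ i x ∂α - ∫⁻ x, φ i x ∂β)) :=
        Finset.sum_le_sum fun i _ ↦ le_add_tsub
    _ ≤ β (thickening δ B ∩ L) + η := by
        rw [Finset.sum_add_distrib]
        exact add_le_add h2 ((Finset.sum_le_univ_sum_of_nonneg fun _ ↦ zero_le).trans hη)
    _ ≤ β.restrict K (thickening δ B) + (β (L \ K) + η) := by
        rw [← add_assoc]
        exact add_le_add h3 le_rfl

theorem exists_measure_closedBall_le_of_vagueDist_lt [PseudoMetricSpace X] [ProperSpace X]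
    [MeasurableSpace X] (ρ : X) {μ : ℕ → Measure X}
    [∀ n, IsFiniteMeasureOnCompacts (μ n)]
    (hμ : ∀ ε : ℝ≥0∞, 0 < ε → ∃ N, ∀ m ≥ N, ∀ n ≥ N, vagueDist ρ (μ m) (μ n) < ε)
    {R : ℝ} (hR : 0 ≤ R) : ∃ (N : ℕ) (C : ℝ≥0), ∀ n ≥ N, μ n (closedBall ρ R) ≤ C := by
  obtain ⟨N, hN⟩ := hμ (ENNReal.ofReal (Real.exp (-(R + 1))) * 1) (by simp [Real.exp_pos])
  have hfin : μ N (closedBall ρ (R + 1)) + 1 ≠ ⊤ :=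
    ENNReal.add_ne_top.2 ⟨(isCompact_closedBall ρ _).measure_lt_top.ne, ENNReal.one_ne_top⟩
  refine ⟨N, (μ N (closedBall ρ (R + 1)) + 1).toNNReal, fun n hn ↦ ?_⟩
  rw [ENNReal.coe_toNNReal hfin]
  obtain ⟨r, hr, hlt⟩ :=
    exists_levyProkhorovEDist_lt_of_vagueDist_lt ρ hR le_rfl (hN n hn N le_rfl)
  calc μ n (closedBall ρ R) ≤ μ n (closedBall ρ r) :=
        measure_mono (closedBall_subset_closedBall hr.1.le)
    _ = (μ n).restrict (closedBall ρ r) univ := by simp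
    _ ≤ (μ N).restrict (closedBall ρ r) (thickening (1 : ℝ≥0∞).toReal univ) + 1 :=
        left_measure_le_of_levyProkhorovEDist_lt hlt MeasurableSet.univ
    _ ≤ μ N (closedBall ρ (R + 1)) + 1 := by
        refine add_le_add ((measure_mono (subset_univ _)).trans ?_) le_rfl
        rw [Measure.restrict_apply_univ]
        exact measure_mono (closedBall_subset_closedBall hr.2)

theorem exists_closedBall_eq_zero [PseudoMetricSpace X] (ρ : X) (f : C_c(X, ℝ≥0)) :
    ∃ j : ℕ, ∀ x ∉ closedBall ρ j, f x = 0 := by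
  obtain ⟨R, hR⟩ := f.hasCompactSupport.isBounded.subset_closedBall ρ
  obtain ⟨j, hj⟩ := exists_nat_ge R
  exact ⟨j, fun x hx ↦ image_eq_zero_of_notMem_tsupport fun h ↦
    hx (closedBall_subset_closedBall hj (hR h))⟩

variable [MetricSpace X] [ProperSpace X] [MeasurableSpace X] [BorelSpace X]

theorem measurable_levyProkhorovEDist_restrict_closedBall (ρ : X) (μ ν : Measure X)
    [IsFiniteMeasureOnCompacts μ] [IsFiniteMeasureOnCompacts ν] :
    Measurable fun r : ℝ ↦
      levyProkhorovEDist (μ.restrict (closedBall ρ r)) (ν.restrict (closedBall ρ r)) := by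
  set D : ℝ → ℝ≥0∞ := fun r ↦
    levyProkhorovEDist (μ.restrict (closedBall ρ r)) (ν.restrict (closedBall ρ r))
  set F : ℝ → ℝ≥0∞ := fun r ↦ μ (closedBall ρ r) + ν (closedBall ρ r)
  have hF : Monotone F := fun r s hrs ↦ add_le_add
    (measure_mono (closedBall_subset_closedBall hrs))
    (measure_mono (closedBall_subset_closedBall hrs))
  have hDF : Monotone fun r ↦ D r + F r := fun r s hrs ↦ by
    have hsub : closedBall ρ r ⊆ closedBall ρ s := closedBall_subset_closedBall hrs
    have hsplit (κ : Measure X) :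
        κ (closedBall ρ s \ closedBall ρ r) + κ (closedBall ρ r) = κ (closedBall ρ s) :=
      measure_sdiff_add_inter (closedBall ρ s) measurableSet_closedBall |>.symm ▸ by
        rw [inter_eq_self_of_subset_right hsub]
    have hD : D r ≤ μ (closedBall ρ s \ closedBall ρ r) +
        (D s + ν (closedBall ρ s \ closedBall ρ r)) :=
      (levyProkhorovEDist_triangle _ (μ.restrict (closedBall ρ s)) _).trans <| add_le_add
        (levyProkhorovEDist_restrict_le μ hsub measurableSet_closedBall) <|
        (levyProkhorovEDist_triangle _ (ν.restrict (closedBall ρ s)) _).trans <|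
        add_le_add le_rfl <| (levyProkhorovEDist_comm _ _).trans_le <|
        levyProkhorovEDist_restrict_le ν hsub measurableSet_closedBall
    calc D r + F r
        ≤ μ (closedBall ρ s \ closedBall ρ r) + (D s + ν (closedBall ρ s \ closedBall ρ r)) + F r :=
          add_le_add hD le_rfl
      _ = D s + ((μ (closedBall ρ s \ closedBall ρ r) + μ (closedBall ρ r)) +
            (ν (closedBall ρ s \ closedBall ρ r) + ν (closedBall ρ r))) := by
          simp only [F]; ring
      _ = D s + F s := by rw [hsplit μ, hsplit ν]
  have h : D = fun r ↦ (D r + F r) - F r := by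
    funext r
    refine (ENNReal.add_sub_cancel_right ?_).symm
    exact ENNReal.add_ne_top.2 ⟨(isCompact_closedBall ρ r).measure_lt_top.ne,
      (isCompact_closedBall ρ r).measure_lt_top.ne⟩
  rw [h]
  exact hDF.measurable.sub hF.measurable

theorem measurable_vagueDist_integrand (ρ : X) (μ ν : Measure X)
    [IsFiniteMeasureOnCompacts μ] [IsFiniteMeasureOnCompacts ν] :
    Measurable fun r : ℝ ↦ ENNReal.ofReal (Real.exp (-r)) *
      min 1 (levyProkhorovEDist (μ.restrict (closedBall ρ r)) (ν.restrict (closedBall ρ r))) := by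
  have := measurable_levyProkhorovEDist_restrict_closedBall ρ μ ν
  fun_prop

theorem vagueDist_triangle (ρ : X) (μ ν ξ : Measure X) [IsFiniteMeasureOnCompacts μ]
    [IsFiniteMeasureOnCompacts ν] :
    vagueDist ρ μ ξ ≤ vagueDist ρ μ ν + vagueDist ρ ν ξ := by
  rw [vagueDist, vagueDist, vagueDist,
    ← lintegral_add_left (measurable_vagueDist_integrand ρ μ ν)]
  refine lintegral_mono fun r ↦ ?_
  rw [← mul_add]
  gcongr
  refine (min_le_min le_rfl (levyProkhorovEDist_triangle _ (ν.restrict (closedBall ρ r)) _)).trans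
    ?_
  rcases le_total 1 (levyProkhorovEDist (μ.restrict (closedBall ρ r)) (ν.restrict (closedBall ρ r)))
    with h | h
  · rw [min_eq_left h]
    exact (min_le_left _ _).trans le_self_add
  · rw [min_eq_right h]
    rcases le_total 1
      (levyProkhorovEDist (ν.restrict (closedBall ρ r)) (ξ.restrict (closedBall ρ r))) with h' | h'
    · rw [min_eq_left h']
      exact (min_le_left _ _).trans le_add_self
    · rw [min_eq_right h']
      exact min_le_right _ _

theorem eq_of_vagueDist_eq_zero (ρ : X) {μ ν : Measure X} [IsFiniteMeasureOnCompacts μ]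
    [IsFiniteMeasureOnCompacts ν] (h : vagueDist ρ μ ν = 0) : μ = ν := by
  rw [vagueDist, lintegral_eq_zero_iff (measurable_vagueDist_integrand ρ μ ν)] at h
  have hball : ∀ n : ℕ, ∃ r ≥ (n : ℝ),
      μ.restrict (closedBall ρ r) = ν.restrict (closedBall ρ r) := by
    intro n
    have h' : ∀ᵐ r ∂(volume.restrict (Ioi (n : ℝ))), levyProkhorovEDist
        (μ.restrict (closedBall ρ r)) (ν.restrict (closedBall ρ r)) = 0 := by
      filter_upwards [ae_restrict_of_ae_restrict_of_subset (Ioi_subset_Ioi n.cast_nonneg) h]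
        with r hr
      simp only [Pi.zero_apply, mul_eq_zero, ENNReal.ofReal_eq_zero, (Real.exp_pos _).not_ge,
        false_or] at hr
      rcases min_eq_iff.1 hr with hr | hr
      · exact absurd hr.1 one_ne_zero
      · exact hr.1
    have hne : (ae (volume.restrict (Ioi (n : ℝ)))).NeBot := by
      rw [ae_neBot, Ne, Measure.restrict_eq_zero]
      simp
    obtain ⟨r, hr, hnr⟩ := (h'.and (ae_restrict_mem measurableSet_Ioi)).exists
    have := isFiniteMeasure_restrict_closedBall μ ρ r
    have := isFiniteMeasure_restrict_closedBall ν ρ r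
    exact ⟨r, (mem_Ioi.1 hnr).le, eq_of_levyProkhorovEDist_eq_zero hr⟩
  choose r hr hμν using hball
  refine Measure.ext_of_iUnion_eq_univ (s := fun n ↦ closedBall ρ (r n)) ?_ hμν
  refine eq_univ_of_forall fun x ↦ mem_iUnion.2 ?_
  obtain ⟨n, hn⟩ := exists_nat_ge (dist x ρ)
  exact ⟨n, mem_closedBall.2 (hn.trans (hr n))⟩

/-- Vague convergence: convergence of the integrals of compactly supported continuous functions. -/
def VagueTendsto (μ : ℕ → Measure X) (ν : Measure X) : Prop :=
  ∀ f : C_c(X, ℝ≥0), Tendsto (fun n ↦ ∫⁻ x, f x ∂μ n) atTop (𝓝 (∫⁻ x, f x ∂ν))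

theorem VagueTendsto.eventually_measure_annulus_le {μ : ℕ → Measure X} {ν : Measure X}
    (h : VagueTendsto μ ν) [∀ n, IsFiniteMeasureOnCompacts (μ n)] [IsFiniteMeasureOnCompacts ν]
    (ρ : X) {r δ : ℝ} (hδ : 0 < δ) {η : ℝ≥0∞} (hη : η ≠ 0) (hη' : η ≠ ⊤)
    (hν : ν (closedBall ρ (r + 2 * δ)) ≤ ν (closedBall ρ (r - 2 * δ)) + η) :
    ∀ᶠ n in atTop, μ n (closedBall ρ (r + δ) \ closedBall ρ r) ≤ η + η := by
  obtain ⟨u, hu1, hu, hu0⟩ := exists_ball_cutoff ρ (r + δ) hδ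
  obtain ⟨v, hv1, hv, hv0⟩ := exists_ball_cutoff ρ (r - 2 * δ) hδ
  have huν : ∫⁻ x, u x ∂ν ≤ ν (closedBall ρ (r + 2 * δ)) := by
    rw [← lintegral_indicator_one measurableSet_closedBall]
    refine lintegral_mono fun x ↦ ?_
    by_cases hx : x ∈ closedBall ρ (r + 2 * δ)
    · simpa [hx] using hu1 x
    · have := hu0 x (by rwa [show r + δ + δ = r + 2 * δ by ring])
      simp [this]
  have hvν : ν (closedBall ρ (r - 2 * δ)) ≤ ∫⁻ x, v x ∂ν := by
    rw [← lintegral_indicator_one measurableSet_closedBall]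
    refine lintegral_mono fun x ↦ ?_
    by_cases hx : x ∈ closedBall ρ (r - 2 * δ)
    · simp [hx, hv x hx]
    · simp [hx]
  have hlt : ∫⁻ x, u x ∂ν < ∫⁻ x, v x ∂ν + (η + η) := by
    refine (huν.trans (hν.trans (add_le_add hvν le_rfl))).trans_lt ?_
    exact ENNReal.add_lt_add_left (lintegral_compactlySupported_ne_top ν v)
      (ENNReal.lt_add_right hη' hη)
  filter_upwards [(h u).eventually_lt ((h v).add_const (η + η)) hlt] with n hn
  have key : μ n (closedBall ρ (r + δ) \ closedBall ρ r) + ∫⁻ x, v x ∂μ n ≤ ∫⁻ x, u x ∂μ n := by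
    rw [← lintegral_indicator_one (measurableSet_closedBall.diff measurableSet_closedBall),
      ← lintegral_add_left (measurable_one.indicator
        (measurableSet_closedBall.diff measurableSet_closedBall))]
    refine lintegral_mono fun x ↦ ?_
    by_cases hx : x ∈ closedBall ρ r
    · have hx' : x ∈ closedBall ρ (r + δ) := closedBall_subset_closedBall (by linarith) hx
      simpa [hx, hu x hx'] using hv1 x
    · have hvx : v x = 0 := hv0 x fun h ↦ hx (closedBall_subset_closedBall (by linarith) h)
      by_cases hx' : x ∈ closedBall ρ (r + δ)
      · simp [hvx, hu x hx',
          indicator_of_mem (show x ∈ closedBall ρ (r + δ) \ closedBall ρ r from ⟨hx', hx⟩)]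
      · simp [hvx, hx']
  rw [add_comm] at key
  exact (ENNReal.add_le_add_iff_left (lintegral_compactlySupported_ne_top (μ n) v)).1
    (key.trans hn.le)

theorem VagueTendsto.tendsto_levyProkhorovEDist {μ : ℕ → Measure X} {ν : Measure X}
    (h : VagueTendsto μ ν) [∀ n, IsFiniteMeasureOnCompacts (μ n)] [IsFiniteMeasureOnCompacts ν]
    (ρ : X) {r : ℝ} (hr : ContinuousAt (fun s ↦ ν (closedBall ρ s)) r) :
    Tendsto (fun n ↦ levyProkhorovEDist ((μ n).restrict (closedBall ρ r))
      (ν.restrict (closedBall ρ r))) atTop (𝓝 0) := by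
  rw [ENNReal.tendsto_nhds_zero]
  intro ε' hε'
  obtain ⟨ε, hε, hεε'⟩ := ENNReal.lt_iff_exists_nnreal_btwn.1 hε'
  replace hε : 0 < ε := by exact_mod_cast hε
  set η : ℝ≥0∞ := (ε : ℝ≥0∞) / 2 / 2
  have hη0 : η ≠ 0 := by simp [η, hε.ne']
  have hηt : η ≠ ⊤ := by finiteness
  have hηε : η + η = (ε : ℝ≥0∞) / 2 := ENNReal.add_halves _
  obtain ⟨δ, hδ, hδε, hνδ⟩ : ∃ δ : ℝ, 0 < δ ∧ δ ≤ ε ∧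
      ν (closedBall ρ (r + 2 * δ)) ≤ ν (closedBall ρ (r - 2 * δ)) + η := by
    have hfin : ν (closedBall ρ r) ≠ ⊤ := (isCompact_closedBall ρ r).measure_lt_top.ne
    have hη2 : η / 2 ≠ 0 := by simp [hη0]
    have e1 := hr.eventually_lt_const (ENNReal.lt_add_right hfin hη2)
    have e2 := (hr.add_const (η / 2)).eventually_const_lt (ENNReal.lt_add_right hfin hη2)
    obtain ⟨d, hd, hball⟩ := Metric.eventually_nhds_iff.1 (e1.and e2)
    refine ⟨min (d / 3) ε, lt_min (by positivity) hε, min_le_right _ _, ?_⟩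
    have hle : min (d / 3) (ε : ℝ) ≤ d / 3 := min_le_left _ _
    have hpos : 0 < min (d / 3) (ε : ℝ) := lt_min (by positivity) hε
    have b1 := (hball (y := r + 2 * min (d / 3) ε)
      (by rw [Real.dist_eq, abs_lt]; constructor <;> linarith)).1
    have b2 := (hball (y := r - 2 * min (d / 3) ε)
      (by rw [Real.dist_eq, abs_lt]; constructor <;> linarith)).2
    calc _ ≤ ν (closedBall ρ r) + η / 2 := b1.le
      _ ≤ _ := add_le_add b2.le le_rfl
      _ = _ := by rw [add_assoc, ENNReal.add_halves]
  obtain ⟨t, _, φ, hφK, hφ1, hφL, hφδ⟩ := exists_fine_partition (isCompact_closedBall ρ r) hδ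
  have hL : thickening δ (closedBall ρ r) ⊆ closedBall ρ (r + δ) := fun x hx ↦ by
    obtain ⟨z, hz, hxz⟩ := mem_thickening_iff.1 hx
    rw [mem_closedBall] at hz ⊢
    linarith [dist_triangle x z ρ]
  have hφt (i : t) : ∫⁻ x, φ i x ∂ν ≠ ⊤ := lintegral_compactlySupported_ne_top ν (φ i)
  have t1 : Tendsto (fun n ↦ ∑ i, (∫⁻ x, φ i x ∂μ n - ∫⁻ x, φ i x ∂ν)) atTop (𝓝 0) := by
    rw [← Finset.sum_const_zero (ι := t) (s := Finset.univ)]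
    refine tendsto_finsetSum _ fun i _ ↦ ?_
    simpa using ENNReal.Tendsto.sub (h (φ i)) (tendsto_const_nhds (x := ∫⁻ x, φ i x ∂ν))
      (Or.inl (hφt i))
  have t2 : Tendsto (fun n ↦ ∑ i, (∫⁻ x, φ i x ∂ν - ∫⁻ x, φ i x ∂μ n)) atTop (𝓝 0) := by
    rw [← Finset.sum_const_zero (ι := t) (s := Finset.univ)]
    refine tendsto_finsetSum _ fun i _ ↦ ?_
    simpa using ENNReal.Tendsto.sub (tendsto_const_nhds (x := ∫⁻ x, φ i x ∂ν)) (h (φ i))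
      (Or.inl (hφt i))
  have hε2 : (0 : ℝ≥0∞) < ε / 2 := ENNReal.half_pos (by simpa using hε.ne')
  have hconst : VagueTendsto (fun _ ↦ ν) ν := fun f ↦ tendsto_const_nhds
  obtain ⟨_, hνann⟩ := (hconst.eventually_measure_annulus_le ρ hδ hη0 hηt hνδ).exists
  filter_upwards [ENNReal.tendsto_nhds_zero.1 t1 _ hε2, ENNReal.tendsto_nhds_zero.1 t2 _ hε2,
    h.eventually_measure_annulus_le ρ hδ hη0 hηt hνδ] with n h1 h2 hμann
  have hbound {α β : Measure X} {B : Set X} (hB : MeasurableSet B)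
      (hβ : β (closedBall ρ (r + δ) \ closedBall ρ r) ≤ η + η)
      (hαβ : ∑ i, (∫⁻ x, φ i x ∂α - ∫⁻ x, φ i x ∂β) ≤ ε / 2) :
      α.restrict (closedBall ρ r) B ≤
        β.restrict (closedBall ρ r) (thickening (ε : ℝ≥0∞).toReal B) + ε := by
    refine (restrict_le_restrict_thickening_add (fun i ↦ (map_continuous (φ i)).measurable)
      measurableSet_closedBall hφK hφ1 (fun i x hx ↦ hL (hφL i x hx)) hφδ hαβ hB).trans ?_
    refine add_le_add (measure_mono (thickening_mono hδε B)) ?_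
    exact (add_le_add (hβ.trans_eq hηε) le_rfl).trans_eq (ENNReal.add_halves _)
  refine le_trans (sInf_le fun B hB ↦ ?_) hεε'.le
  exact ⟨hbound hB hνann h1, hbound hB hμann h2⟩

theorem lintegral_exp_neg_Ioi_ne_top : ∫⁻ r in Ioi (0 : ℝ), ENNReal.ofReal (Real.exp (-r)) ≠ ⊤ :=
  (integrableOn_exp_neg_Ioi 0).lintegral_lt_top.ne

theorem VagueTendsto.tendsto_vagueDist {μ : ℕ → Measure X} {ν : Measure X}
    (h : VagueTendsto μ ν) [∀ n, IsFiniteMeasureOnCompacts (μ n)] [IsFiniteMeasureOnCompacts ν]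
    (ρ : X) : Tendsto (fun n ↦ vagueDist ρ (μ n) ν) atTop (𝓝 0) := by
  have hmono : Monotone fun s ↦ ν (closedBall ρ s) := fun _ _ hst ↦
    measure_mono (closedBall_subset_closedBall hst)
  rw [← lintegral_zero (μ := volume.restrict (Ioi (0 : ℝ)))]
  refine tendsto_lintegral_of_dominated_convergence (fun r ↦ ENNReal.ofReal (Real.exp (-r)))
    (fun n ↦ measurable_vagueDist_integrand ρ (μ n) ν) (fun n ↦ ae_of_all _ fun r ↦ ?_)
    lintegral_exp_neg_Ioi_ne_top (ae_restrict_of_ae ?_)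
  · exact mul_le_of_le_one_right' (min_le_left _ _)
  · have hae : ∀ᵐ r ∂(volume : Measure ℝ), ContinuousAt (fun s ↦ ν (closedBall ρ s)) r :=
      hmono.countable_not_continuousAt.measure_zero _
    filter_upwards [hae] with r hr
    have := (tendsto_const_nhds (x := (1 : ℝ≥0∞))).min (h.tendsto_levyProkhorovEDist ρ hr)
    simpa using ENNReal.Tendsto.const_mul this (Or.inr ENNReal.ofReal_ne_top)

theorem exists_tendsto_lintegral_of_vagueDist_lt (ρ : X) {μ : ℕ → Measure X}
    [∀ n, IsFiniteMeasureOnCompacts (μ n)]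
    (hμ : ∀ ε : ℝ≥0∞, 0 < ε → ∃ N, ∀ m ≥ N, ∀ n ≥ N, vagueDist ρ (μ m) (μ n) < ε)
    (f : C_c(X, ℝ≥0)) :
    ∃ l : ℝ≥0, Tendsto (fun n ↦ ∫⁻ x, f x ∂μ n) atTop (𝓝 l) := by
  obtain ⟨j, hj⟩ := exists_closedBall_eq_zero ρ f
  obtain ⟨N₀, C, hC⟩ := exists_measure_closedBall_le_of_vagueDist_lt ρ hμ
    (show (0 : ℝ) ≤ j + 1 by positivity)
  obtain ⟨M, hM⟩ : ∃ M : ℝ≥0, ∀ x, f x ≤ M := by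
    obtain ⟨M, hM⟩ := (f.hasCompactSupport.isCompact_range (map_continuous f)).bddAbove
    exact ⟨M, fun x ↦ hM (mem_range_self x)⟩
  have huc : UniformContinuous f :=
    f.hasCompactSupport.uniformContinuous_of_continuous (map_continuous f)
  have key : ∀ ε : ℝ≥0, 0 < ε → ∃ N, ∀ m ≥ N, ∀ n ≥ N,
      ∫⁻ x, f x ∂μ m ≤ ∫⁻ x, f x ∂μ n + ε := by
    intro ε hε
    set η : ℝ≥0 := ε / 2 / (C + 1)
    have hη : 0 < η := by positivity
    have hηC : η * C ≤ ε / 2 := by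
      calc η * C ≤ η * (C + 1) := by gcongr; exact le_self_add
        _ = ε / 2 := div_mul_cancel₀ _ (by positivity)
    obtain ⟨δ, hδ, hfδ⟩ := Metric.uniformContinuous_iff.1 huc η hη
    set c : ℝ≥0 := min (min 1 δ.toNNReal) (ε / 2 / (M + 1))
    have hc0 : 0 < c := lt_min (lt_min one_pos (Real.toNNReal_pos.2 hδ)) (by positivity)
    have hc1 : c ≤ 1 := (min_le_left _ _).trans (min_le_left _ _)
    have hcM : c * M ≤ ε / 2 := by
      calc c * M ≤ ε / 2 / (M + 1) * (M + 1) :=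
            mul_le_mul' (min_le_right _ _) le_self_add
        _ = ε / 2 := div_mul_cancel₀ _ (by positivity)
    have hcδ : (c : ℝ) ≤ δ := by
      have : c ≤ δ.toNNReal := (min_le_left _ _).trans (min_le_right _ _)
      exact (NNReal.coe_le_coe.2 this).trans_eq (Real.coe_toNNReal _ hδ.le)
    have hfc (x y : X) (hxy : dist x y < c) : f x ≤ f y + η := by
      have := hfδ (hxy.trans_le hcδ)
      rw [NNReal.dist_eq] at this
      refine NNReal.coe_le_coe.1 ?_
      push_cast
      linarith [le_abs_self ((f x : ℝ) - f y)]
    obtain ⟨N₁, hN₁⟩ := hμ (ENNReal.ofReal (Real.exp (-(j + 1))) * c)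
      (ENNReal.mul_pos (by simp [Real.exp_pos]) (by simpa using hc0.ne'))
    refine ⟨max N₀ N₁, fun m hm n hn ↦ ?_⟩
    obtain ⟨r, hr, hlt⟩ := exists_levyProkhorovEDist_lt_of_vagueDist_lt ρ j.cast_nonneg
      (by exact_mod_cast hc1)
      (hN₁ m ((le_max_right _ _).trans hm) n ((le_max_right _ _).trans hn))
    have hrestr (κ : Measure X) : ∫⁻ x in closedBall ρ r, f x ∂κ = ∫⁻ x, f x ∂κ := by
      refine setLIntegral_eq_of_support_subset fun x hx ↦ ?_
      by_contra hxr
      exact hx (by simp [hj x fun h ↦ hxr (closedBall_subset_closedBall hr.1.le h)])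
    have hle := lintegral_le_of_levyProkhorovEDist_lt (map_continuous f).measurable hM hfc hlt
    rw [hrestr, hrestr, Measure.restrict_apply_univ] at hle
    refine hle.trans (add_le_add le_rfl ?_)
    calc (η : ℝ≥0∞) * μ n (closedBall ρ r) + c * M ≤ η * C + c * M := by
          gcongr
          exact (measure_mono (closedBall_subset_closedBall hr.2)).trans
            (hC n ((le_max_left _ _).trans hn))
      _ = ((η * C + c * M : ℝ≥0) : ℝ≥0∞) := by push_cast; rfl
      _ ≤ ε := by
          refine ENNReal.coe_le_coe.2 ?_
          calc η * C + c * M ≤ ε / 2 + ε / 2 := add_le_add hηC hcM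
            _ = ε := add_halves ε
  set a : ℕ → ℝ≥0 := fun n ↦ (∫⁻ x, f x ∂μ n).toNNReal
  have ha (n : ℕ) : (a n : ℝ≥0∞) = ∫⁻ x, f x ∂μ n :=
    ENNReal.coe_toNNReal (lintegral_compactlySupported_ne_top (μ n) f)
  have hcauchy : CauchySeq a := by
    rw [Metric.cauchySeq_iff]
    intro ε hε
    obtain ⟨N, hN⟩ := key (ε / 2).toNNReal (Real.toNNReal_pos.2 (half_pos hε))
    have hN' : ∀ m ≥ N, ∀ n ≥ N, (a m : ℝ) ≤ a n + ε / 2 := fun m hm n hn ↦ by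
      have := hN m hm n hn
      rw [← ha, ← ha, ← ENNReal.coe_add, ENNReal.coe_le_coe, ← NNReal.coe_le_coe,
        NNReal.coe_add, Real.coe_toNNReal _ (half_pos hε).le] at this
      exact this
    refine ⟨N, fun m hm n hn ↦ ?_⟩
    rw [NNReal.dist_eq, abs_lt]
    constructor <;> linarith [hN' m hm n hn, hN' n hn m hm]
  obtain ⟨l, hl⟩ := cauchySeq_tendsto_of_complete hcauchy
  exact ⟨l, by simpa only [← ha] using ENNReal.tendsto_coe.2 hl⟩

theorem exists_vagueTendsto {μ : ℕ → Measure X} (h : ∀ f : C_c(X, ℝ≥0),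
      ∃ l : ℝ≥0, Tendsto (fun n ↦ ∫⁻ x, f x ∂μ n) atTop (𝓝 l)) :
    ∃ ν : Measure X, IsFiniteMeasureOnCompacts ν ∧ VagueTendsto μ ν := by
  choose L hL using h
  let Λ : C_c(X, ℝ≥0) →ₗ[ℝ≥0] ℝ≥0 :=
    { toFun := L
      map_add' := fun f g ↦ by
        refine ENNReal.coe_injective (tendsto_nhds_unique (hL (f + g)) ?_)
        rw [ENNReal.coe_add]
        refine ((hL f).add (hL g)).congr fun n ↦ ?_
        rw [← lintegral_add_left (map_continuous f).measurable.coe_nnreal_ennreal]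
        simp
      map_smul' := fun c f ↦ by
        refine ENNReal.coe_injective (tendsto_nhds_unique (hL (c • f)) ?_)
        rw [RingHom.id_apply, smul_eq_mul, ENNReal.coe_mul]
        refine (ENNReal.Tendsto.const_mul (hL f) (Or.inr ENNReal.coe_ne_top)).congr fun n ↦ ?_
        rw [← lintegral_const_mul _ (map_continuous f).measurable.coe_nnreal_ennreal]
        simp }
  refine ⟨NNRealRMK.rieszMeasure Λ, inferInstance, fun f ↦ ?_⟩
  rw [NNRealRMK.lintegral_rieszMeasure]
  exact hL f

theorem VagueTendsto.of_dense (ρ : X) {χ : ℕ → C_c(X, ℝ≥0)}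
    (hχ : ∀ j : ℕ, ∀ x ∈ closedBall ρ j, χ j x = 1)
    {S : Set C(X, ℝ≥0)} (hS : Dense S) (h1S : 1 ∈ S)
    {ν : ℕ → Measure X} {μ : Measure X} [∀ n, IsFiniteMeasureOnCompacts (ν n)]
    [IsFiniteMeasureOnCompacts μ]
    (h : ∀ g ∈ S, ∀ j, Tendsto (fun n ↦ ∫⁻ x, (g x * χ j x : ℝ≥0) ∂ν n) atTop
      (𝓝 (∫⁻ x, (g x * χ j x : ℝ≥0) ∂μ))) :
    VagueTendsto ν μ := by
  intro f
  obtain ⟨j, hj⟩ := exists_closedBall_eq_zero ρ f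
  have hfχ (x : X) : f x * χ j x = f x := by
    by_cases hx : x ∈ closedBall ρ j
    · rw [hχ j x hx, mul_one]
    · rw [hj x hx, zero_mul]
  have hfin (κ : Measure X) [IsFiniteMeasureOnCompacts κ] (g : C(X, ℝ≥0)) :
      ∫⁻ x, (g x * χ j x : ℝ≥0) ∂κ ≠ ⊤ :=
    lintegral_compactlySupported_ne_top κ
      ⟨⟨fun x ↦ g x * χ j x, by fun_prop⟩, (χ j).hasCompactSupport.mul_left⟩
  have hffin (κ : Measure X) [IsFiniteMeasureOnCompacts κ] : ∫⁻ x, f x ∂κ ≠ ⊤ :=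
    lintegral_compactlySupported_ne_top κ f
  rw [← ENNReal.tendsto_toReal_iff (fun n ↦ hffin (ν n)) (hffin μ)]
  have h' (g : C(X, ℝ≥0)) (hg : g ∈ S) := (ENNReal.tendsto_toReal_iff
    (fun n ↦ hfin (ν n) g) (hfin μ g)).2 (h g hg j)
  set I : Measure X → C(X, ℝ≥0) → ℝ := fun κ g ↦ (∫⁻ x, (g x * χ j x : ℝ≥0) ∂κ).toReal
  have hmul {g₁ g₂ : C(X, ℝ≥0)} {e : ℝ≥0} (hg : ∀ x, χ j x ≠ 0 → g₁ x ≤ g₂ x + e)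
      (κ : Measure X) [IsFiniteMeasureOnCompacts κ] : I κ g₁ ≤ I κ g₂ + e * I κ 1 := by
    have hle : ∫⁻ x, (g₁ x * χ j x : ℝ≥0) ∂κ ≤
        ∫⁻ x, (g₂ x * χ j x : ℝ≥0) ∂κ + e * ∫⁻ x, ((1 : C(X, ℝ≥0)) x * χ j x : ℝ≥0) ∂κ := by
      have hmeas (g : C(X, ℝ≥0)) : Measurable fun x ↦ ((g x * χ j x : ℝ≥0) : ℝ≥0∞) :=
        (show Continuous fun x ↦ g x * χ j x by fun_prop).measurable.coe_nnreal_ennreal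
      rw [← lintegral_const_mul _ (hmeas 1), ← lintegral_add_left (hmeas g₂)]
      refine lintegral_mono fun x ↦ ?_
      by_cases hx : χ j x = 0
      · simp [hx]
      · rw [← ENNReal.coe_mul, ← ENNReal.coe_add, ENNReal.coe_le_coe, ContinuousMap.one_apply,
          one_mul, ← add_mul]
        exact mul_le_mul' (hg x hx) le_rfl
    have := ENNReal.toReal_mono (ENNReal.add_ne_top.2
      ⟨hfin κ g₂, ENNReal.mul_ne_top ENNReal.coe_ne_top (hfin κ 1)⟩) hle
    rwa [ENNReal.toReal_add (hfin κ g₂) (ENNReal.mul_ne_top ENNReal.coe_ne_top (hfin κ 1)),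
      ENNReal.toReal_mul, ENNReal.coe_toReal] at this
  have hIf (κ : Measure X) : (∫⁻ x, f x ∂κ).toReal = I κ f.toContinuousMap := by
    simp only [I, CompactlySupportedContinuousMap.coe_toContinuousMap, hfχ]
  simp only [hIf]
  have hI1 : 0 ≤ I μ 1 := ENNReal.toReal_nonneg
  rw [Metric.tendsto_atTop]
  intro ε hε
  set e : ℝ≥0 := (ε / 2 / (2 * I μ 1 + 1)).toNNReal
  have he0 : 0 < ε / 2 / (2 * I μ 1 + 1) := by positivity
  have he : (e : ℝ) * (2 * I μ 1 + 1) = ε / 2 := by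
    rw [Real.coe_toNNReal _ he0.le]
    exact div_mul_cancel₀ _ (by positivity)
  obtain ⟨g, hgS, hg⟩ : ∃ g ∈ S, ∀ x, χ j x ≠ 0 → dist (f x) (g x) < e := by
    obtain ⟨u, huS, hu⟩ := mem_closure_iff_seq_limit.1 (hS f.toContinuousMap)
    have hunif := ContinuousMap.tendsto_iff_forall_isCompact_tendstoUniformlyOn.1 hu _
      (χ j).hasCompactSupport
    obtain ⟨n, hn⟩ := (Metric.tendstoUniformlyOn_iff.1 hunif e (Real.toNNReal_pos.2 he0)).exists
    exact ⟨u n, huS n, fun x hx ↦ hn x (subset_tsupport _ hx)⟩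
  have hfg (x : X) (hx : χ j x ≠ 0) : f.toContinuousMap x ≤ g x + e := by
    have := hg x hx
    rw [NNReal.dist_eq, abs_lt] at this
    refine NNReal.coe_le_coe.1 ?_
    push_cast [CompactlySupportedContinuousMap.coe_toContinuousMap]
    linarith
  have hgf (x : X) (hx : χ j x ≠ 0) : g x ≤ f.toContinuousMap x + e := by
    have := hg x hx
    rw [NNReal.dist_eq, abs_lt] at this
    refine NNReal.coe_le_coe.1 ?_
    push_cast [CompactlySupportedContinuousMap.coe_toContinuousMap]
    linarith
  obtain ⟨N₁, hN₁⟩ := Metric.tendsto_atTop.1 (h' 1 h1S) 1 one_pos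
  obtain ⟨N₂, hN₂⟩ := Metric.tendsto_atTop.1 (h' g hgS) (ε / 2) (half_pos hε)
  refine ⟨max N₁ N₂, fun n hn ↦ ?_⟩
  have b1 : |I (ν n) 1 - I μ 1| < 1 := hN₁ n ((le_max_left _ _).trans hn)
  have b2 : |I (ν n) g - I μ g| < ε / 2 := hN₂ n ((le_max_right _ _).trans hn)
  rw [abs_lt] at b1 b2
  have b3 : (e : ℝ) * I (ν n) 1 ≤ e * (I μ 1 + 1) := by
    gcongr
    linarith
  rw [Real.dist_eq, abs_lt]
  constructor <;>
    linarith [hmul hfg (ν n), hmul hgf (ν n), hmul hfg μ, hmul hgf μ]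

theorem exists_countable_forall_vagueTendsto (ρ : X) :
    ∃ D : Set (Measure X), D.Countable ∧ (∀ ν ∈ D, IsFiniteMeasureOnCompacts ν) ∧
      ∀ μ : Measure X, IsFiniteMeasureOnCompacts μ →
        ∃ ν : ℕ → Measure X, (∀ n, ν n ∈ D) ∧ VagueTendsto ν μ := by
  choose χ _ hχ _ using fun j : ℕ ↦ exists_ball_cutoff ρ j one_pos
  obtain ⟨S₀, hS₀c, hS₀⟩ := TopologicalSpace.exists_countable_dense C(X, ℝ≥0)
  set S : Set C(X, ℝ≥0) := insert 1 S₀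
  have hSc : Countable S := (hS₀c.insert 1).to_subtype
  let Φ : {μ : Measure X // IsFiniteMeasureOnCompacts μ} → S × ℕ → ℝ≥0∞ := fun μ p ↦
    ∫⁻ x, ((p.1 : C(X, ℝ≥0)) x * χ p.2 x : ℝ≥0) ∂μ.1
  let _ : TopologicalSpace {μ : Measure X // IsFiniteMeasureOnCompacts μ} :=
    .induced Φ inferInstance
  have hΦ : Topology.IsInducing Φ := ⟨rfl⟩
  have : SecondCountableTopology {μ : Measure X // IsFiniteMeasureOnCompacts μ} :=
    hΦ.secondCountableTopology
  obtain ⟨D, hDc, hD⟩ :=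
    TopologicalSpace.exists_countable_dense {μ : Measure X // IsFiniteMeasureOnCompacts μ}
  refine ⟨Subtype.val '' D, hDc.image _, ?_, fun μ hμ ↦ ?_⟩
  · rintro _ ⟨ν, _, rfl⟩
    exact ν.2
  · obtain ⟨u, huD, hu⟩ := mem_closure_iff_seq_limit.1 (hD ⟨μ, hμ⟩)
    rw [hΦ.tendsto_nhds_iff, tendsto_pi_nhds] at hu
    have (n : ℕ) : IsFiniteMeasureOnCompacts (u n).1 := (u n).2
    exact ⟨fun n ↦ (u n).1, fun n ↦ mem_image_of_mem _ (huD n),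
      VagueTendsto.of_dense ρ hχ (hS₀.mono (subset_insert 1 S₀)) (mem_insert 1 S₀)
        fun g hg j ↦ hu (⟨g, hg⟩, j)⟩

end VagueDist

/-- **The vague metric is a complete separable metric on the Radon measures of a proper
metric space**: it is symmetric, vanishes exactly on equal pairs, satisfies the triangle
inequality, is complete, and is separable (all statements relative to the Borel measures
finite on compact sets). -/
theorem vagueDist_metric_complete_separable
    {X : Type*} [MetricSpace X] [ProperSpace X] [MeasurableSpace X] [BorelSpace X] (ρ : X) :
    (∀ μ ν : Measure X, (∀ K : Set X, IsCompact K → μ K < ⊤) →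
        (∀ K : Set X, IsCompact K → ν K < ⊤) → vagueDist ρ μ ν = vagueDist ρ ν μ) ∧
    (∀ μ ν : Measure X, (∀ K : Set X, IsCompact K → μ K < ⊤) →
        (∀ K : Set X, IsCompact K → ν K < ⊤) → (vagueDist ρ μ ν = 0 ↔ μ = ν)) ∧
    (∀ μ ν ξ : Measure X, (∀ K : Set X, IsCompact K → μ K < ⊤) →
        (∀ K : Set X, IsCompact K → ν K < ⊤) → (∀ K : Set X, IsCompact K → ξ K < ⊤) →
        vagueDist ρ μ ξ ≤ vagueDist ρ μ ν + vagueDist ρ ν ξ) ∧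
    (∀ μ : ℕ → Measure X, (∀ n, ∀ K : Set X, IsCompact K → μ n K < ⊤) →
        (∀ ε : ℝ≥0∞, 0 < ε → ∃ N : ℕ, ∀ m ≥ N, ∀ n ≥ N, vagueDist ρ (μ m) (μ n) < ε) →
        ∃ ν : Measure X, (∀ K : Set X, IsCompact K → ν K < ⊤) ∧
          Tendsto (fun n => vagueDist ρ (μ n) ν) atTop (𝓝 0)) ∧
    (∃ 𝒟 : Set (Measure X), 𝒟.Countable ∧
        (∀ ν ∈ 𝒟, ∀ K : Set X, IsCompact K → ν K < ⊤) ∧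
        ∀ μ : Measure X, (∀ K : Set X, IsCompact K → μ K < ⊤) →
          ∀ ε : ℝ≥0∞, 0 < ε → ∃ ν ∈ 𝒟, vagueDist ρ μ ν < ε) := by
  have fin {κ : Measure X} (h : ∀ K : Set X, IsCompact K → κ K < ⊤) : IsFiniteMeasureOnCompacts κ :=
    ⟨fun {K} hK ↦ h K hK⟩
  refine ⟨fun μ ν _ _ ↦ vagueDist_comm ρ μ ν, fun μ ν hμ hν ↦ ⟨fun h ↦ ?_, ?_⟩,
    fun μ ν ξ hμ hν _ ↦ ?_, fun μ hμ hcauchy ↦ ?_, ?_⟩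
  · have := fin hμ
    have := fin hν
    exact eq_of_vagueDist_eq_zero ρ h
  · rintro rfl
    exact vagueDist_self ρ μ
  · have := fin hμ
    have := fin hν
    exact vagueDist_triangle ρ μ ν ξ
  · have (n : ℕ) := fin (hμ n)
    obtain ⟨ν, hν, hμν⟩ :=
      exists_vagueTendsto fun f ↦ exists_tendsto_lintegral_of_vagueDist_lt ρ hcauchy f
    exact ⟨ν, fun K hK ↦ hK.measure_lt_top, hμν.tendsto_vagueDist ρ⟩
  · obtain ⟨D, hDc, hD, hdense⟩ := exists_countable_forall_vagueTendsto ρ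
    refine ⟨D, hDc, fun ν hν K hK ↦ ?_, fun μ hμ ε hε ↦ ?_⟩
    · have := hD ν hν
      exact hK.measure_lt_top
    · have := fin hμ
      obtain ⟨ν, hνD, hν⟩ := hdense μ this
      have (n : ℕ) := hD (ν n) (hνD n)
      obtain ⟨n, hn⟩ := ((hν.tendsto_vagueDist ρ).eventually_lt_const hε).exists
      exact ⟨ν n, hνD n, vagueDist_comm ρ μ (ν n) ▸ hn⟩
end

section
/- Let X be a proper metric space equipped with its Borel σ-algebra, let ρ ∈ X, and let μ, μ₁, μ₂, … be Borel measures on X that are finite on compact sets. Then V_ρ(μ_n, μ) → 0 if and only if μ_n → μ vaguely, i.e. ∫_X f dμ_n → ∫_X f dμ for every continuous function f : X → ℝ with compact support. -/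
open Metric Set MeasureTheory Filter
open scoped ENNReal Topology

namespace VagueConvergence

lemma exists_continuous_measure_le_integral_le {X : Type*} [TopologicalSpace X] [T2Space X]
    [LocallyCompactSpace X] [MeasurableSpace X] [BorelSpace X] {K U : Set X}
    (hK : IsCompact K) (hU : IsOpen U) (hKU : K ⊆ U) :
    ∃ f : X → ℝ, Continuous f ∧ HasCompactSupport f ∧
      ∀ ν : Measure X, IsFiniteMeasureOnCompacts ν →
        ν K ≤ ENNReal.ofReal (∫ x, f x ∂ν) ∧ ENNReal.ofReal (∫ x, f x ∂ν) ≤ ν U := by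
  obtain ⟨f, hf1, hf0, hfc, hf⟩ := exists_continuous_one_zero_of_isCompact hK hU.isClosed_compl
    (disjoint_compl_right_iff_subset.mpr hKU)
  refine ⟨f, f.continuous, hfc, fun ν hν => ?_⟩
  rw [ofReal_integral_eq_lintegral_ofReal (f.continuous.integrable_of_hasCompactSupport hfc)
    (Eventually.of_forall fun x => (hf x).1)]
  constructor
  · rw [← lintegral_indicator_one hK.measurableSet]
    refine lintegral_mono fun x => ?_
    by_cases hx : x ∈ K
    · simp [hx, hf1 hx]
    · simp [hx]
  · rw [← lintegral_indicator_one hU.measurableSet]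
    refine lintegral_mono fun x => ?_
    by_cases hx : x ∈ U
    · simpa [hx] using (hf x).2
    · simp [hx, hf0 hx]

/-- Vague convergence forces convergence of the measures of relatively compact continuity sets. -/
lemma eventually_measure_le_add_of_null_frontier {X : Type*} [MetricSpace X]
    [ProperSpace X] [MeasurableSpace X] [BorelSpace X] {μ : Measure X}
    [IsFiniteMeasureOnCompacts μ] {μs : ℕ → Measure X} [∀ n, IsFiniteMeasureOnCompacts (μs n)]
    (h : ∀ f : X → ℝ, Continuous f → HasCompactSupport f →
        Tendsto (fun n => ∫ x, f x ∂(μs n)) atTop (𝓝 (∫ x, f x ∂μ)))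
    {E : Set X} (hE : IsCompact (closure E)) (hE0 : μ (frontier E) = 0)
    {ε : ℝ≥0∞} (hε : ε ≠ 0) :
    ∀ᶠ n in atTop, μs n E ≤ μ E + ε ∧ μ E ≤ μs n E + ε := by
  have hcl : μ (closure E) = μ E := measure_closure_of_null_frontier hE0
  have hin : μ (interior E) = μ E := measure_interior_of_null_frontier hE0
  have htop : μ E ≠ ∞ := hcl ▸ hE.measure_lt_top.ne
  apply Eventually.and
  · obtain ⟨U, hEU, hU, hUε⟩ := (closure E).exists_isOpen_lt_add (hcl ▸ htop) hε
    obtain ⟨f, hf, hfc, hfν⟩ := exists_continuous_measure_le_integral_le hE hU hEU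
    have hlt : ENNReal.ofReal (∫ x, f x ∂μ) < μ E + ε :=
      hcl ▸ (hfν μ inferInstance).2.trans_lt hUε
    filter_upwards [(ENNReal.tendsto_ofReal (h f hf hfc)).eventually_lt_const hlt] with n hn
    exact (measure_mono subset_closure).trans ((hfν (μs n) inferInstance).1.trans hn.le)
  · obtain ⟨K, hKE, hK, hKε⟩ := isOpen_interior.measurableSet.exists_isCompact_lt_add
      (μ := μ) (hin ▸ htop) hε
    obtain ⟨f, hf, hfc, hfν⟩ := exists_continuous_measure_le_integral_le hK isOpen_interior hKE
    have hlt : μ E < ENNReal.ofReal (∫ x, f x ∂μ) + ε :=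
      (hin ▸ hKε).trans_le (by gcongr; exact (hfν μ inferInstance).1)
    filter_upwards [((ENNReal.tendsto_ofReal (h f hf hfc)).add_const ε).eventually_const_lt hlt]
      with n hn
    refine hn.le.trans ?_
    gcongr
    exact (hfν (μs n) inferInstance).2.trans (measure_mono interior_subset)

lemma countable_measure_sphere_ne_zero {X : Type*} [MetricSpace X] [MeasurableSpace X]
    [OpensMeasurableSpace X] (μ : Measure X) [SFinite μ] (x : X) :
    {r : ℝ | μ (sphere x r) ≠ 0}.Countable := by
  simp_rw [← pos_iff_ne_zero]
  refine Measure.countable_meas_pos_of_disjoint_iUnion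
    (fun r => isClosed_sphere.measurableSet) fun r s hrs => ?_
  exact disjoint_left.2 fun y hr hs => hrs (hr.symm.trans hs)

lemma exists_measure_sphere_eq_zero {X : Type*} [MetricSpace X] [MeasurableSpace X]
    [OpensMeasurableSpace X] (μ : Measure X) [SFinite μ] (x : X) {ε : ℝ} (hε : 0 < ε) :
    ∃ r, 0 < r ∧ r < ε ∧ μ (sphere x r) = 0 := by
  obtain ⟨r, hr, hr0⟩ := ((countable_measure_sphere_ne_zero μ x).dense_compl ℝ).exists_between hε
  exact ⟨r, hr0.1, hr0.2, by simpa using hr⟩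

lemma measure_frontier_biUnion_finset_eq_zero {X ι : Type*} [TopologicalSpace X]
    [MeasurableSpace X] {μ : Measure X} {A : ι → Set X} (u : Finset ι)
    (hA : ∀ i ∈ u, μ (frontier (A i)) = 0) : μ (frontier (⋃ i ∈ u, A i)) = 0 := by
  classical
  induction u using Finset.induction_on with
  | empty => simp
  | insert i u _ ih =>
    rw [Finset.set_biUnion_insert]
    refine measure_mono_null ((frontier_union_subset _ _).trans
      (union_subset_union inter_subset_left inter_subset_right)) ?_
    rw [measure_union_null_iff]
    exact ⟨hA i (by simp), ih fun j hj => hA j (by simp [hj])⟩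

lemma tendsto_levyProkhorovEDist_restrict_closedBall {X : Type*} [MetricSpace X]
    [ProperSpace X] [MeasurableSpace X] [BorelSpace X] {μ : Measure X}
    [IsFiniteMeasureOnCompacts μ] {μs : ℕ → Measure X} [∀ n, IsFiniteMeasureOnCompacts (μs n)]
    (h : ∀ f : X → ℝ, Continuous f → HasCompactSupport f →
        Tendsto (fun n => ∫ x, f x ∂(μs n)) atTop (𝓝 (∫ x, f x ∂μ)))
    {ρ : X} {r : ℝ} (hr : μ (sphere ρ r) = 0) :
    Tendsto (fun n => levyProkhorovEDist ((μs n).restrict (closedBall ρ r))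
      (μ.restrict (closedBall ρ r))) atTop (𝓝 0) := by
  classical
  rw [ENNReal.tendsto_nhds_zero]
  intro ε hε
  rcases eq_or_ne ε ∞ with rfl | hεt
  · simp
  set B := closedBall ρ r with hB
  have hε' : 0 < ε.toReal := ENNReal.toReal_pos hε.ne' hεt
  choose s hs0 hsε hs using fun x => exists_measure_sphere_eq_zero μ x (half_pos hε')
  obtain ⟨t, -, ht⟩ := (isCompact_closedBall ρ r).elim_nhds_subcover (fun x => ball x (s x))
    fun x _ => ball_mem_nhds x (hs0 x)
  let E : Finset X → Set X := fun u => (⋃ x ∈ u, ball x (s x)) ∩ B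
  have hE : ∀ u ∈ t.powerset, ∀ᶠ n in atTop,
      μs n (E u) ≤ μ (E u) + ε ∧ μ (E u) ≤ μs n (E u) + ε := by
    intro u _
    refine eventually_measure_le_add_of_null_frontier h ?_ ?_ hε.ne'
    · exact (isCompact_closedBall ρ r).of_isClosed_subset isClosed_closure
        (closure_minimal inter_subset_right isClosed_closedBall)
    · refine measure_mono_null ((frontier_inter_subset _ _).trans
        (union_subset_union inter_subset_left inter_subset_right)) ?_
      rw [measure_union_null_iff]
      exact ⟨measure_frontier_biUnion_finset_eq_zero u fun x _ =>
        measure_mono_null frontier_ball_subset_sphere (hs x),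
        measure_mono_null frontier_closedBall_subset_sphere hr⟩
  have key : ∀ ν κ : Measure X, (∀ u ∈ t.powerset, ν (E u) ≤ κ (E u) + ε) →
      ∀ A, MeasurableSet A → ν.restrict B A ≤ κ.restrict B (thickening ε.toReal A) + ε := by
    intro ν κ hνκ A hA
    rw [Measure.restrict_apply hA, Measure.restrict_apply isOpen_thickening.measurableSet]
    let u := t.filter fun x => (ball x (s x) ∩ A).Nonempty
    calc ν (A ∩ B) ≤ ν (E u) := by
          refine measure_mono fun y hy => ⟨?_, hy.2⟩
          obtain ⟨x, hx, hyx⟩ := mem_iUnion₂.1 (ht hy.2)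
          exact mem_iUnion₂.2 ⟨x, Finset.mem_filter.2 ⟨hx, y, hyx, hy.1⟩, hyx⟩
      _ ≤ κ (E u) + ε := hνκ u (Finset.mem_powerset.2 (Finset.filter_subset _ _))
      _ ≤ κ (thickening ε.toReal A ∩ B) + ε := by
          gcongr
          refine inter_subset_inter_left _ (iUnion₂_subset fun x hx y hy => ?_)
          obtain ⟨z, hzx, hzA⟩ := (Finset.mem_filter.1 hx).2
          refine mem_thickening_iff.2 ⟨z, hzA, ?_⟩
          rw [mem_ball] at hy hzx
          have := dist_triangle_right y z x
          linarith [hsε x]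
  filter_upwards [(Filter.eventually_all_finset t.powerset).2 hE] with n hn
  exact sInf_le fun A hA => ⟨key _ _ (fun u hu => (hn u hu).1) A hA,
    key _ _ (fun u hu => (hn u hu).2) A hA⟩

lemma tendsto_vagueDist_of_vague {X : Type*} [MetricSpace X]
    [ProperSpace X] [MeasurableSpace X] [BorelSpace X] (ρ : X) {μ : Measure X}
    [IsFiniteMeasureOnCompacts μ] {μs : ℕ → Measure X} [∀ n, IsFiniteMeasureOnCompacts (μs n)]
    (h : ∀ f : X → ℝ, Continuous f → HasCompactSupport f →
        Tendsto (fun n => ∫ x, f x ∂(μs n)) atTop (𝓝 (∫ x, f x ∂μ))) :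
    Tendsto (fun n => vagueDist ρ (μs n) μ) atTop (𝓝 0) := by
  unfold vagueDist
  choose g hgm hgle hg using fun n => exists_measurable_le_lintegral_eq
    (volume.restrict (Ioi (0 : ℝ))) fun r => ENNReal.ofReal (Real.exp (-r)) *
      min 1 (levyProkhorovEDist ((μs n).restrict (closedBall ρ r)) (μ.restrict (closedBall ρ r)))
  simp_rw [hg]
  rw [← lintegral_zero (μ := volume.restrict (Ioi (0 : ℝ)))]
  refine tendsto_lintegral_of_dominated_convergence (fun r => ENNReal.ofReal (Real.exp (-r)))
    hgm (fun n => Eventually.of_forall fun r => (hgle n r).trans ?_) ?_ ?_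
  · exact mul_le_of_le_one_right' (min_le_left _ _)
  · rw [← ofReal_integral_eq_lintegral_ofReal (integrableOn_exp_neg_Ioi 0)
      (Eventually.of_forall fun r => (Real.exp_pos _).le)]
    exact ENNReal.ofReal_ne_top
  · filter_upwards [(countable_measure_sphere_ne_zero μ ρ).ae_notMem _] with r hr
    have hlim := tendsto_levyProkhorovEDist_restrict_closedBall h (ρ := ρ) (r := r)
      (by simpa using hr)
    refine tendsto_of_tendsto_of_tendsto_of_le_of_le tendsto_const_nhds ?_
      (fun n => zero_le) (fun n => hgle n r)
    have := ENNReal.Tendsto.const_mul (a := ENNReal.ofReal (Real.exp (-r)))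
      ((tendsto_const_nhds (x := (1 : ℝ≥0∞))).min hlim) (Or.inr ENNReal.ofReal_ne_top)
    simpa using this

lemma exists_levyProkhorovEDist_lt_of_vagueDist_lt {X : Type*} [PseudoMetricSpace X]
    [MeasurableSpace X] {ρ : X} {μ ν : Measure X} {R : ℝ} (hR : 0 ≤ R) {δ : ℝ≥0∞}
    (h : vagueDist ρ μ ν < ENNReal.ofReal (Real.exp (-(R + 1))) * min 1 δ) :
    ∃ r ∈ Ioc R (R + 1),
      levyProkhorovEDist (μ.restrict (closedBall ρ r)) (ν.restrict (closedBall ρ r)) < δ := by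
  by_contra! hcon
  refine h.not_ge ?_
  calc ENNReal.ofReal (Real.exp (-(R + 1))) * min 1 δ
      = ∫⁻ _ in Ioc R (R + 1), ENNReal.ofReal (Real.exp (-(R + 1))) * min 1 δ := by simp
    _ ≤ ∫⁻ r in Ioc R (R + 1), ENNReal.ofReal (Real.exp (-r)) *
          min 1 (levyProkhorovEDist (μ.restrict (closedBall ρ r))
            (ν.restrict (closedBall ρ r))) := by
        refine setLIntegral_mono' measurableSet_Ioc fun r hr => ?_
        have := hcon r hr
        have := hr.2
        gcongr
    _ ≤ vagueDist ρ μ ν := lintegral_mono_set fun r hr => hR.trans_lt hr.1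

lemma integral_le_integral_add_of_levyProkhorovEDist_lt {X : Type*} [PseudoMetricSpace X]
    [MeasurableSpace X] [OpensMeasurableSpace X] {μ ν : Measure X} [IsFiniteMeasure μ]
    [IsFiniteMeasure ν] {ε η : ℝ} (hε : 0 < ε) (hη : 0 ≤ η)
    (hμν : levyProkhorovEDist μ ν < ENNReal.ofReal ε) (f : BoundedContinuousFunction X ℝ)
    (hf : ∀ x, 0 ≤ f x) (hfη : ∀ x y, dist x y < ε → f x ≤ f y + η) :
    ∫ x, f x ∂μ ≤ ∫ x, f x ∂ν + η * ν.real univ + ε * ‖f‖ := by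
  refine (f.integral_le_of_levyProkhorovEDist_lt μ ν hε hμν (Eventually.of_forall hf)).trans ?_
  gcongr
  let g : BoundedContinuousFunction X ℝ := f + BoundedContinuousFunction.const X η
  have hg : ∀ x, g x = f x + η := fun x => rfl
  have hfg : ‖f‖ ≤ ‖g‖ := (BoundedContinuousFunction.norm_le (norm_nonneg _)).2 fun x => by
    rw [Real.norm_of_nonneg (hf x)]
    linarith [hg x, g.apply_le_norm x]
  have hint : ∫ x, g x ∂ν = ∫ x, f x ∂ν + η * ν.real univ := by
    simp_rw [hg]
    rw [integral_add (f.integrable ν) (integrable_const η)]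
    simp [mul_comm]
  rw [← hint, g.integral_eq_integral_meas_le ν
    (Eventually.of_forall fun x => (add_nonneg (hf x) hη : 0 ≤ f x + η))]
  have hintble : ∀ (S : ℝ → Set X), Antitone S → ∀ C : ℝ,
      IntegrableOn (fun t => ν.real (S t)) (Ioc 0 C) := fun S hS C =>
    IntegrableOn.mono_set (AntitoneOn.integrableOn_isCompact isCompact_Icc
      (fun s _ t _ hst => measureReal_mono (hS hst))) Ioc_subset_Icc_self
  have hga : Antitone fun t : ℝ => {x | t ≤ g x} := fun s t hst x hx => hst.trans hx
  calc ∫ t in Ioc 0 ‖f‖, ν.real (thickening ε {a | t ≤ f a})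
      ≤ ∫ t in Ioc 0 ‖f‖, ν.real {a | t ≤ g a} := by
        refine setIntegral_mono (hintble _ ?_ _) (hintble _ hga _) fun t =>
          measureReal_mono fun x hx => ?_
        · exact fun s t hst => thickening_subset_of_subset ε fun x hx => hst.trans hx
        · obtain ⟨z, hz, hxz⟩ := mem_thickening_iff.1 hx
          have hz' : t ≤ f z := hz
          exact hz'.trans (hfη z x (by rwa [dist_comm]))
    _ ≤ ∫ t in Ioc 0 ‖g‖, ν.real {a | t ≤ g a} :=
        setIntegral_mono_set (hintble _ hga _)
          (Eventually.of_forall fun t => measureReal_nonneg)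
          (Ioc_subset_Ioc_right hfg).eventuallyLE

lemma tendsto_integral_of_tendsto_vagueDist_of_nonneg {X : Type*} [MetricSpace X]
    [ProperSpace X] [MeasurableSpace X] [BorelSpace X] {ρ : X} {μ : Measure X}
    [IsFiniteMeasureOnCompacts μ] {μs : ℕ → Measure X} [∀ n, IsFiniteMeasureOnCompacts (μs n)]
    (h : Tendsto (fun n => vagueDist ρ (μs n) μ) atTop (𝓝 0)) {f : X → ℝ} (hf : Continuous f)
    (hfc : HasCompactSupport f) (hf0 : ∀ x, 0 ≤ f x) :
    Tendsto (fun n => ∫ x, f x ∂(μs n)) atTop (𝓝 (∫ x, f x ∂μ)) := by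
  obtain ⟨C, hC⟩ := hf.bounded_above_of_compact_support hfc
  let F : BoundedContinuousFunction X ℝ := BoundedContinuousFunction.ofNormedAddCommGroup f hf C hC
  have hF : ∀ x, F x = f x := fun x => rfl
  obtain ⟨R, hR0, hR⟩ := hfc.isBounded.subset_closedBall_lt 0 ρ
  set M := μ.real (closedBall ρ (R + 1)) with hM
  have hM0 : 0 ≤ M := measureReal_nonneg
  rw [Metric.tendsto_nhds]
  intro e he
  set η := e / (2 * (M + 1)) with hη
  have hη0 : 0 < η := by positivity
  obtain ⟨δ, hδ0, hδ⟩ := Metric.uniformContinuous_iff.1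
    (hf.uniformContinuous_of_tendsto_cocompact hfc.is_zero_at_infty) η hη0
  set ε := min δ (min 1 (e / (2 * (‖F‖ + 1)))) with hε
  have hε0 : 0 < ε := by positivity
  have hε1 : ε ≤ 1 := (min_le_right _ _).trans (min_le_left _ _)
  have hεF : ε * ‖F‖ < e / 2 := by
    calc ε * ‖F‖ ≤ e / (2 * (‖F‖ + 1)) * ‖F‖ := by
          gcongr
          exact (min_le_right _ _).trans (min_le_right _ _)
      _ < e / (2 * (‖F‖ + 1)) * (‖F‖ + 1) := by gcongr; linarith
      _ = e / 2 := by field_simp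
  have hηM : η * (M + 1) = e / 2 := by rw [hη]; field_simp
  have hosc : ∀ x y, dist x y < ε → F x ≤ F y + η := fun x y hxy => by
    have := hδ (hxy.trans_le (min_le_left _ _))
    rw [Real.dist_eq] at this
    linarith [le_abs_self (f x - f y), hF x, hF y]
  have hpos : 0 < ENNReal.ofReal (Real.exp (-(R + 1))) * min 1 (ENNReal.ofReal ε) :=
    ENNReal.mul_pos (by simpa using Real.exp_pos _) (by simpa using hε0)
  filter_upwards [h.eventually_lt_const hpos] with n hn
  obtain ⟨r, hr, hd⟩ := exists_levyProkhorovEDist_lt_of_vagueDist_lt hR0.le hn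
  have : IsFiniteMeasure ((μs n).restrict (closedBall ρ r)) :=
    isFiniteMeasure_restrict.2 (isCompact_closedBall ρ r).measure_lt_top.ne
  have : IsFiniteMeasure (μ.restrict (closedBall ρ r)) :=
    isFiniteMeasure_restrict.2 (isCompact_closedBall ρ r).measure_lt_top.ne
  have hrestr : ∀ ν : Measure X, ∫ x in closedBall ρ r, F x ∂ν = ∫ x, f x ∂ν := fun ν =>
    setIntegral_eq_integral_of_forall_compl_eq_zero fun x hx =>
      image_eq_zero_of_notMem_tsupport fun hxs =>
        hx (closedBall_subset_closedBall hr.1.le (hR hxs))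
  have hmass : (μ.restrict (closedBall ρ r)).real univ ≤ M := by
    rw [measureReal_restrict_apply_univ]
    exact measureReal_mono (closedBall_subset_closedBall hr.2)
      (isCompact_closedBall ρ (R + 1)).measure_lt_top.ne
  have hmass' : ((μs n).restrict (closedBall ρ r)).real univ ≤ M + 1 := by
    have h1 := left_measure_le_of_levyProkhorovEDist_lt hd MeasurableSet.univ
    have h2 := ENNReal.toReal_mono (by finiteness)
      (h1.trans (add_le_add_left (measure_mono (subset_univ _)) _))
    rw [ENNReal.toReal_add (by finiteness) (by finiteness), ENNReal.toReal_ofReal hε0.le] at h2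
    exact h2.trans (add_le_add hmass hε1)
  have h1 := integral_le_integral_add_of_levyProkhorovEDist_lt hε0 hη0.le hd F hf0 hosc
  have h2 := integral_le_integral_add_of_levyProkhorovEDist_lt hε0 hη0.le
    (by rwa [levyProkhorovEDist_comm]) F hf0 hosc (μ := μ.restrict (closedBall ρ r))
      (ν := (μs n).restrict (closedBall ρ r))
  rw [hrestr, hrestr] at h1 h2
  have h3 := mul_le_mul_of_nonneg_left (hmass.trans (by linarith : M ≤ M + 1)) hη0.le
  have h4 := mul_le_mul_of_nonneg_left hmass' hη0.le
  rw [Real.dist_eq, abs_lt]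
  constructor <;> linarith

lemma tendsto_integral_of_tendsto_vagueDist {X : Type*} [MetricSpace X]
    [ProperSpace X] [MeasurableSpace X] [BorelSpace X] {ρ : X} {μ : Measure X}
    [IsFiniteMeasureOnCompacts μ] {μs : ℕ → Measure X} [∀ n, IsFiniteMeasureOnCompacts (μs n)]
    (h : Tendsto (fun n => vagueDist ρ (μs n) μ) atTop (𝓝 0)) {f : X → ℝ} (hf : Continuous f)
    (hfc : HasCompactSupport f) :
    Tendsto (fun n => ∫ x, f x ∂(μs n)) atTop (𝓝 (∫ x, f x ∂μ)) := by
  have hp : Continuous fun x => max (f x) 0 := by fun_prop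
  have hm : Continuous fun x => max (-f x) 0 := by fun_prop
  have hpc : HasCompactSupport fun x => max (f x) 0 :=
    hfc.comp_left (g := fun t => max t 0) (by simp)
  have hmc : HasCompactSupport fun x => max (-f x) 0 :=
    hfc.comp_left (g := fun t => max (-t) 0) (by simp)
  have hsub : ∀ ν : Measure X, IsFiniteMeasureOnCompacts ν →
      ∫ x, f x ∂ν = ∫ x, max (f x) 0 ∂ν - ∫ x, max (-f x) 0 ∂ν := fun ν _ => by
    rw [← integral_sub (hp.integrable_of_hasCompactSupport hpc)
      (hm.integrable_of_hasCompactSupport hmc)]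
    congr with x
    simp
  rw [hsub μ inferInstance]
  simp_rw [fun n => hsub (μs n) inferInstance]
  exact (tendsto_integral_of_tendsto_vagueDist_of_nonneg h hp hpc fun x => le_max_right _ _).sub
    (tendsto_integral_of_tendsto_vagueDist_of_nonneg h hm hmc fun x => le_max_right _ _)

end VagueConvergence

/-- **The vague metric metrizes vague convergence**: for Borel measures finite on compact
sets on a proper metric space, `V_ρ(μ_n, μ) → 0` iff `∫ f dμ_n → ∫ f dμ` for every
continuous `f : X → ℝ` with compact support. -/
theorem vagueDist_tendsto_iff_vague
    {X : Type*} [MetricSpace X] [ProperSpace X] [MeasurableSpace X] [BorelSpace X] (ρ : X)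
    (μ : Measure X) (hμ : ∀ K : Set X, IsCompact K → μ K < ⊤)
    (μs : ℕ → Measure X) (hμs : ∀ n, ∀ K : Set X, IsCompact K → μs n K < ⊤) :
    Tendsto (fun n => vagueDist ρ (μs n) μ) atTop (𝓝 0) ↔
      ∀ f : X → ℝ, Continuous f → HasCompactSupport f →
        Tendsto (fun n => ∫ x, f x ∂(μs n)) atTop (𝓝 (∫ x, f x ∂μ)) := by
  have : IsFiniteMeasureOnCompacts μ := ⟨fun K hK => hμ K hK⟩
  have : ∀ n, IsFiniteMeasureOnCompacts (μs n) := fun n => ⟨fun K hK => hμs n K hK⟩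
  exact ⟨fun h _ hf hfc => VagueConvergence.tendsto_integral_of_tendsto_vagueDist h hf hfc,
    VagueConvergence.tendsto_vagueDist_of_vague ρ⟩
end

section
/- Let X and Ξ be metric spaces, and equip X × Ξ with the max product metric. For each n ∈ ℕ let K_n ⊆ X be compact and f_n : X → Ξ be continuous on K_n, and let K ⊆ X be compact and f : X → Ξ be continuous on K. Write Γ_n := {(x, f_n(x)) : x ∈ K_n} and Γ := {(x, f(x)) : x ∈ K}. Then the following are equivalent: (i) dHe(Γ_n, Γ) → 0; (ii) dHe(K_n, K) → 0, and for every y ∈ K and every sequence (x_n) in X with x_n ∈ K_n for all sufficiently large n and x_n → y, one has f_n(x_n) → f(y) in Ξ. -/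
open Metric Set Filter
open scoped ENNReal Topology

section Helpers

variable {α β : Type*}

theorem edist_lt_of_lt_half [PseudoEMetricSpace α] {x y z : α} {ε : ℝ≥0∞}
    (h₁ : edist x y < ε / 2) (h₂ : edist y z < ε / 2) : edist x z < ε :=
  calc edist x z ≤ edist x y + edist y z := edist_triangle _ _ _
    _ < ε / 2 + ε / 2 := ENNReal.add_lt_add h₁ h₂
    _ = ε := ENNReal.add_halves ε

theorem tendsto_hausdorffEDist_zero_iff [PseudoEMetricSpace α] {ι : Type*} {l : Filter ι}
    {S : ι → Set α} {T : Set α} :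
    Tendsto (fun n => hausdorffEDist (S n) T) l (𝓝 0) ↔
      ∀ ε > 0, ∀ᶠ n in l,
        (∀ x ∈ S n, ∃ y ∈ T, edist x y < ε) ∧ ∀ y ∈ T, ∃ x ∈ S n, edist x y < ε := by
  rw [ENNReal.tendsto_nhds_zero]
  constructor
  · intro h ε hε
    obtain ⟨η, hη, hηε⟩ := exists_between hε
    filter_upwards [h η hη] with n hn
    refine ⟨fun x hx => exists_edist_lt_of_hausdorffEDist_lt hx (hn.trans_lt hηε),
      fun y hy => ?_⟩
    rw [hausdorffEDist_comm] at hn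
    obtain ⟨x, hx, hxy⟩ := exists_edist_lt_of_hausdorffEDist_lt hy (hn.trans_lt hηε)
    exact ⟨x, hx, by rwa [edist_comm]⟩
  · intro h ε hε
    filter_upwards [h ε hε] with n hn
    refine hausdorffEDist_le_of_mem_edist (fun x hx => ?_) fun y hy => ?_
    · obtain ⟨y, hy, hxy⟩ := hn.1 x hx
      exact ⟨y, hy, hxy.le⟩
    · obtain ⟨x, hx, hxy⟩ := hn.2 y hy
      exact ⟨x, hx, by rw [edist_comm]; exact hxy.le⟩

/-- The points of a Hausdorff limit are limits of sequences of points of the sets. -/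
theorem exists_seq_tendsto_of_tendsto_hausdorffEDist [PseudoEMetricSpace α]
    {K : ℕ → Set α} {L : Set α} (hK : ∀ n, IsCompact (K n))
    (h : Tendsto (fun n => hausdorffEDist (K n) L) atTop (𝓝 0)) {y : α} (hy : y ∈ L) :
    ∃ k : ℕ → α, (∀ᶠ n in atTop, k n ∈ K n) ∧ Tendsto k atTop (𝓝 y) := by
  have hk : ∀ n, ∃ k, (K n).Nonempty → k ∈ K n ∧ infEDist y (K n) = edist y k := by
    intro n
    by_cases hne : (K n).Nonempty
    · obtain ⟨k, hk⟩ := (hK n).exists_infEDist_eq_edist hne y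
      exact ⟨k, fun _ => hk⟩
    · exact ⟨y, fun h => absurd h hne⟩
  choose k hk using hk
  rw [tendsto_hausdorffEDist_zero_iff] at h
  refine ⟨k, ?_, ?_⟩
  · filter_upwards [h 1 one_pos] with n hn
    obtain ⟨x, hx, -⟩ := hn.2 y hy
    exact (hk n ⟨x, hx⟩).1
  · rw [EMetric.tendsto_nhds]
    intro ε hε
    filter_upwards [h ε hε] with n hn
    obtain ⟨x, hx, hxy⟩ := hn.2 y hy
    rw [edist_comm, ← (hk n ⟨x, hx⟩).2]
    exact (infEDist_le_edist_of_mem hx).trans_lt (by rwa [edist_comm])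

/-- Convergence of `f n (x n)` along all sequences `x n → y` with `x n ∈ K n` eventually is
convergence of `f n x` as `n → ∞` and `x → y` jointly with `x ∈ K n`, provided at least one
such sequence exists. -/
theorem tendsto_prod_nhds_inf_principal_of_seq [TopologicalSpace α] [FirstCountableTopology α]
    [TopologicalSpace β] {K : ℕ → Set α} {f : ℕ → α → β} {y : α} {b : β} {k : ℕ → α}
    (hkK : ∀ᶠ n in atTop, k n ∈ K n) (hky : Tendsto k atTop (𝓝 y))
    (h : ∀ x : ℕ → α, (∀ᶠ n in atTop, x n ∈ K n) → Tendsto x atTop (𝓝 y) →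
      Tendsto (fun n => f n (x n)) atTop (𝓝 b)) :
    Tendsto (fun p : ℕ × α => f p.1 p.2)
      ((atTop ×ˢ 𝓝 y) ⊓ 𝓟 {p : ℕ × α | p.2 ∈ K p.1}) (𝓝 b) := by
  refine tendsto_of_subseq_tendsto fun u hu => ?_
  rw [tendsto_inf, tendsto_principal, tendsto_prod_iff'] at hu
  obtain ⟨⟨hu₁, hu₂⟩, huK⟩ := hu
  obtain ⟨m, hm, hφ⟩ := strictMono_subseq_of_tendsto_atTop hu₁
  refine ⟨m, ?_⟩
  set φ : ℕ → ℕ := (fun n => (u n).1) ∘ m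
  set x : ℕ → α := Function.extend φ (fun j => (u (m j)).2) k
  have hxφ (j : ℕ) : x (φ j) = (u (m j)).2 := hφ.injective.extend_apply _ _ j
  have key (P : ℕ → α → Prop) (h₁ : ∀ᶠ j in atTop, P (φ j) (u (m j)).2)
      (h₂ : ∀ᶠ n in atTop, P n (k n)) : ∀ᶠ n in atTop, P n (x n) := by
    obtain ⟨N, hN⟩ := eventually_atTop.1 h₁
    filter_upwards [h₂, eventually_ge_atTop (φ N)] with n hn hNn
    by_cases hex : ∃ j, φ j = n
    · obtain ⟨j, rfl⟩ := hex
      rw [hxφ]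
      exact hN j (hφ.le_iff_le.1 hNn)
    · rwa [show x n = k n from Function.extend_apply' _ _ _ hex]
  have hxK : ∀ᶠ n in atTop, x n ∈ K n :=
    key (fun n z => z ∈ K n) (hm.tendsto_atTop.eventually huK) hkK
  have hxy : Tendsto x atTop (𝓝 y) := fun U hU =>
    key (fun _ z => z ∈ U) ((hu₂.comp hm.tendsto_atTop).eventually hU) (hky.eventually hU)
  refine ((h x hxK hxy).comp hφ.tendsto_atTop).congr fun j => ?_
  rw [Function.comp_apply, hxφ]
  rfl

/-- If `f n x → g y` as `n → ∞` and `x → y` with `x ∈ K n`, for all `y` in a compact set `L`,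
then the convergence is uniform in `y`. -/
theorem IsCompact.exists_forall_edist_lt_of_tendsto [PseudoEMetricSpace α]
    [PseudoEMetricSpace β] {K : ℕ → Set α} {f : ℕ → α → β} {L : Set α} {g : α → β}
    (hL : IsCompact L) (hg : ContinuousOn g L)
    (h : ∀ y ∈ L, Tendsto (fun p : ℕ × α => f p.1 p.2)
      ((atTop ×ˢ 𝓝 y) ⊓ 𝓟 {p : ℕ × α | p.2 ∈ K p.1}) (𝓝 (g y)))
    {ε : ℝ≥0∞} (hε : 0 < ε) :
    ∃ δ > 0, ∀ᶠ n in atTop, ∀ z ∈ L, ∀ x ∈ K n, edist x z < δ →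
      edist (f n x) (g z) < ε := by
  refine hL.induction_on (p := fun s => ∃ δ > 0, ∀ᶠ n in atTop, ∀ z ∈ s, ∀ x ∈ K n,
    edist x z < δ → edist (f n x) (g z) < ε) ?_ ?_ ?_ ?_
  · exact ⟨1, one_pos, by simp⟩
  · rintro s t hst ⟨δ, hδ, ht⟩
    exact ⟨δ, hδ, ht.mono fun n hn z hz => hn z (hst hz)⟩
  · rintro s t ⟨δ, hδ, hs⟩ ⟨δ', hδ', ht⟩
    refine ⟨min δ δ', lt_min hδ hδ', ?_⟩
    filter_upwards [hs, ht] with n hns hnt z hz x hx hxz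
    rcases hz with hz | hz
    · exact hns z hz x hx (hxz.trans_le (min_le_left _ _))
    · exact hnt z hz x hx (hxz.trans_le (min_le_right _ _))
  · intro y hy
    have hε' : 0 < ε / 2 := ENNReal.half_pos hε.ne'
    have hfy := EMetric.tendsto_nhds.1 (h y hy) _ hε'
    rw [eventually_inf_principal, eventually_prod_iff] at hfy
    obtain ⟨P, hP, Q, hQ, hPQ⟩ := hfy
    obtain ⟨δ, hδ, hδQ⟩ := Metric.nhds_basis_eball.eventually_iff.1 hQ
    refine ⟨{z | edist z y < δ / 2 ∧ edist (g z) (g y) < ε / 2}, ?_, δ / 2,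
      ENNReal.half_pos hδ.ne', ?_⟩
    · exact inter_mem
        (mem_nhdsWithin_of_mem_nhds (Metric.eball_mem_nhds y (ENNReal.half_pos hδ.ne')))
        (EMetric.tendsto_nhds.1 (hg y hy) _ hε')
    · filter_upwards [hP] with n hn z hz x hx hxz
      refine edist_lt_of_lt_half (hPQ hn (hδQ (edist_lt_of_lt_half hxz hz.1)) hx) ?_
      rw [edist_comm]
      exact hz.2

end Helpers

/-- **Characterization of Hausdorff convergence of graphs of continuous functions on
variable compact domains**: the graphs `Γ_n = {(x, f_n x) : x ∈ K_n}` converge to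
`Γ = {(x, g x) : x ∈ L}` in the Hausdorff distance on `X × Ξ` (with the max product
metric) iff the domains `K_n` converge to `L` in the Hausdorff distance and
`f_n (x_n) → g y` for every `y ∈ L` and every sequence `x_n → y` with `x_n ∈ K_n`
eventually. -/
theorem hausdorffEdist_graph_tendsto_iff
    {X Ξ : Type*} [MetricSpace X] [MetricSpace Ξ]
    (K : ℕ → Set X) (hK : ∀ n, IsCompact (K n))
    (f : ℕ → X → Ξ) (hf : ∀ n, ContinuousOn (f n) (K n))
    (L : Set X) (hL : IsCompact L) (g : X → Ξ) (hg : ContinuousOn g L) :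
    Tendsto (fun n => EMetric.hausdorffEdist
        ((fun x => (x, f n x)) '' K n) ((fun x => (x, g x)) '' L)) atTop (𝓝 0) ↔
      (Tendsto (fun n => EMetric.hausdorffEdist (K n) L) atTop (𝓝 0) ∧
       ∀ y ∈ L, ∀ x : ℕ → X, (∀ᶠ n in atTop, x n ∈ K n) → Tendsto x atTop (𝓝 y) →
         Tendsto (fun n => f n (x n)) atTop (𝓝 (g y))) := by
  change Tendsto (fun n => hausdorffEDist _ _) _ _ ↔
    Tendsto (fun n => hausdorffEDist _ _) _ _ ∧ _
  constructor
  · intro h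
    rw [tendsto_hausdorffEDist_zero_iff] at h
    simp only [forall_mem_image, exists_mem_image, Prod.edist_eq, max_lt_iff] at h
    refine ⟨tendsto_hausdorffEDist_zero_iff.2 fun ε hε => ?_, fun y hy x hxK hxy => ?_⟩
    · filter_upwards [h ε hε] with n hn
      refine ⟨fun x hx => ?_, fun y hy => ?_⟩
      · obtain ⟨y, hy, hxy, -⟩ := hn.1 hx
        exact ⟨y, hy, hxy⟩
      · obtain ⟨x, hx, hxy, -⟩ := hn.2 hy
        exact ⟨x, hx, hxy⟩
    · rw [EMetric.tendsto_nhds]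
      intro ε hε
      have hε' : 0 < ε / 2 := ENNReal.half_pos hε.ne'
      obtain ⟨δ, hδ, hgδ⟩ := Metric.nhdsWithin_basis_eball.eventually_iff.1
        (EMetric.tendsto_nhds.1 (hg y hy) _ hε')
      have hδ' : 0 < δ / 2 := ENNReal.half_pos hδ.ne'
      filter_upwards [hxK, EMetric.tendsto_nhds.1 hxy _ hδ', h _ (lt_min hδ' hε')]
        with n hn hxn hhn
      obtain ⟨z, hz, hxz, hfz⟩ := hhn.1 hn
      rw [edist_comm] at hxz
      exact edist_lt_of_lt_half (hfz.trans_le (min_le_right _ _))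
        (hgδ ⟨edist_lt_of_lt_half (hxz.trans_le (min_le_left _ _)) hxn, hz⟩)
  · rintro ⟨hKL, hfg⟩
    have hjoint : ∀ y ∈ L, Tendsto (fun p : ℕ × X => f p.1 p.2)
        ((atTop ×ˢ 𝓝 y) ⊓ 𝓟 {p : ℕ × X | p.2 ∈ K p.1}) (𝓝 (g y)) := by
      intro y hy
      obtain ⟨k, hkK, hky⟩ := exists_seq_tendsto_of_tendsto_hausdorffEDist hK hKL hy
      exact tendsto_prod_nhds_inf_principal_of_seq hkK hky (hfg y hy)
    rw [tendsto_hausdorffEDist_zero_iff] at hKL ⊢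
    simp only [forall_mem_image, exists_mem_image, Prod.edist_eq, max_lt_iff]
    intro ε hε
    obtain ⟨δ, hδ, hδε⟩ := hL.exists_forall_edist_lt_of_tendsto hg hjoint hε
    filter_upwards [hKL _ (lt_min hδ hε), hδε] with n hn hnε
    refine ⟨fun x hx => ?_, fun y hy => ?_⟩
    · obtain ⟨y, hy, hxy⟩ := hn.1 x hx
      exact ⟨y, hy, hxy.trans_le (min_le_right _ _),
        hnε y hy x hx (hxy.trans_le (min_le_left _ _))⟩
    · obtain ⟨x, hx, hxy⟩ := hn.2 y hy
      exact ⟨x, hx, hxy.trans_le (min_le_right _ _),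
        hnε y hy x hx (hxy.trans_le (min_le_left _ _))⟩
end

section
/- Let X and Ξ be metric spaces, equip X × Ξ with the max product metric, let ι be a nonempty index set, and for each i ∈ ι let K_i ⊆ X be compact and f_i : X → Ξ be continuous on K_i; write Γ_i := {(x, f_i(x)) : x ∈ K_i}. Then the following are equivalent: (a) for every sequence (i_m) in ι there exist a strictly increasing (m_k), a compact set L ⊆ X, and a function g : X → Ξ continuous on L such that dHe(Γ_{i_{m_k}}, {(x, g(x)) : x ∈ L}) → 0 as k → ∞; (b) all three of: (1) there is a compact K₀ ⊆ X with K_i ⊆ K₀ for all i ∈ ι; (2) the set {f_i(x) : i ∈ ι, x ∈ K_i} has compact closure in Ξ; (3) for every ε > 0 there is δ > 0 such that for all i ∈ ι and all x, y ∈ K_i with dist(x,y) ≤ δ one has dist(f_i(x), f_i(y)) ≤ ε. -/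
open Metric Set Filter
open scoped ENNReal Topology

/-- A sequence of closed subsets of a compact set has a subsequence converging in Hausdorff
distance to a compact set. -/
theorem IsCompact.exists_tendsto_hausdorffEDist_subseq {α : Type*} [MetricSpace α] {T : Set α}
    (hT : IsCompact T) {s : ℕ → Set α} (hs : ∀ n, IsClosed (s n)) (hsT : ∀ n, s n ⊆ T) :
    ∃ φ : ℕ → ℕ, StrictMono φ ∧ ∃ Z : Set α, IsCompact Z ∧
      Tendsto (fun k => hausdorffEDist (s (φ k)) Z) atTop (𝓝 0) := by
  have : CompactSpace T := isCompact_iff_compactSpace.mp hT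
  let u : ℕ → TopologicalSpace.Closeds T := fun n =>
    ⟨Subtype.val ⁻¹' s n, (hs n).preimage continuous_subtype_val⟩
  obtain ⟨Z, φ, hφ, hZ⟩ := CompactSpace.tendsto_subseq u
  refine ⟨φ, hφ, Subtype.val '' (Z : Set T), Z.isClosed.isCompact.image continuous_subtype_val, ?_⟩
  refine (tendsto_iff_edist_tendsto_0.mp hZ).congr fun k => ?_
  rw [Function.comp_apply, TopologicalSpace.Closeds.edist_eq,
    ← hausdorffEDist_image (isometry_subtype_coe (s := T))]
  congr 1
  change Subtype.val '' (Subtype.val ⁻¹' s (φ k)) = _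
  rw [Subtype.image_preimage_coe, inter_eq_right.mpr (hsT _)]

/-- Points of sets converging in Hausdorff distance to a compact set subconverge to a point of
the limit. -/
theorem exists_tendsto_subseq_of_tendsto_hausdorffEDist {α : Type*} [MetricSpace α]
    {s : ℕ → Set α} {Z : Set α} (hZ : IsCompact Z)
    (h : Tendsto (fun k => hausdorffEDist (s k) Z) atTop (𝓝 0)) {w : ℕ → α}
    (hw : ∀ k, w k ∈ s k) :
    ∃ z ∈ Z, ∃ ψ : ℕ → ℕ, StrictMono ψ ∧ Tendsto (w ∘ ψ) atTop (𝓝 z) := by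
  have hne : Z.Nonempty := by
    obtain ⟨k, hk⟩ := (h.eventually (gt_mem_nhds zero_lt_one)).exists
    obtain ⟨y, hy, -⟩ := exists_edist_lt_of_hausdorffEDist_lt (hw k) hk
    exact ⟨y, hy⟩
  choose v hvZ hv using fun k => hZ.exists_infEDist_eq_edist hne (w k)
  have hwv : Tendsto (fun k => edist (v k) (w k)) atTop (𝓝 0) :=
    tendsto_of_tendsto_of_tendsto_of_le_of_le tendsto_const_nhds h (fun _ => zero_le)
      fun k => by
        rw [edist_comm, ← hv k]
        exact infEDist_le_hausdorffEDist_of_mem (hw k)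
  obtain ⟨z, hz, ψ, hψ, hvz⟩ := hZ.tendsto_subseq hvZ
  refine ⟨z, hz, ψ, hψ, ?_⟩
  rw [tendsto_iff_edist_tendsto_0] at hvz ⊢
  have hsum := (hwv.comp hψ.tendsto_atTop).add hvz
  rw [add_zero] at hsum
  refine tendsto_of_tendsto_of_tendsto_of_le_of_le tendsto_const_nhds hsum (fun _ => zero_le)
    fun k => ?_
  simpa only [Function.comp_apply, edist_comm (v (ψ k)) (w (ψ k))] using
    edist_triangle (w (ψ k)) (v (ψ k)) z

/-- Every point of a Hausdorff limit is approximated by points of the converging sets. -/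
theorem eventually_exists_dist_lt_of_tendsto_hausdorffEDist {α : Type*} [MetricSpace α]
    {s : ℕ → Set α} {Z : Set α} (h : Tendsto (fun k => hausdorffEDist (s k) Z) atTop (𝓝 0))
    {z : α} (hz : z ∈ Z) {r : ℝ} (hr : 0 < r) :
    ∀ᶠ k in atTop, ∃ w ∈ s k, dist z w < r := by
  filter_upwards [h.eventually (gt_mem_nhds (ENNReal.ofReal_pos.mpr hr))] with k hk
  rw [hausdorffEDist_comm] at hk
  obtain ⟨w, hw, hzw⟩ := exists_edist_lt_of_hausdorffEDist_lt hz hk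
  exact ⟨w, hw, by rwa [edist_dist, ENNReal.ofReal_lt_ofReal_iff hr] at hzw⟩

/-- If every sequence of members of a family has a subsequence Hausdorff converging to a compact
set, then the union of the family has compact closure. -/
theorem isCompact_closure_iUnion_of_tendsto_hausdorffEDist {α ι : Type*} [MetricSpace α]
    {s : ι → Set α}
    (h : ∀ i : ℕ → ι, ∃ φ : ℕ → ℕ, StrictMono φ ∧ ∃ Z : Set α, IsCompact Z ∧
      Tendsto (fun k => hausdorffEDist (s (i (φ k))) Z) atTop (𝓝 0)) :
    IsCompact (closure (⋃ i, s i)) := by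
  refine IsSeqCompact.isCompact fun z hz => ?_
  choose w hw hzw using fun n : ℕ =>
    Metric.mem_closure_iff.mp (hz n) (1 / ((n : ℝ) + 1)) Nat.one_div_pos_of_nat
  choose i hi using fun n => mem_iUnion.mp (hw n)
  obtain ⟨φ, hφ, Z, hZ, hlim⟩ := h i
  obtain ⟨a, -, ψ, hψ, ha⟩ := exists_tendsto_subseq_of_tendsto_hausdorffEDist hZ hlim
    (w := w ∘ φ) fun k => hi (φ k)
  have hdist : Tendsto (fun n => dist (w n) (z n)) atTop (𝓝 0) :=
    squeeze_zero (fun _ => dist_nonneg) (fun n => by rw [dist_comm]; exact (hzw n).le)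
      tendsto_one_div_add_atTop_nhds_zero_nat
  have hz' : Tendsto (z ∘ φ ∘ ψ) atTop (𝓝 a) :=
    ha.congr_dist (hdist.comp (hφ.comp hψ).tendsto_atTop)
  exact ⟨a, isClosed_closure.mem_of_tendsto hz' (Eventually.of_forall fun _ => hz _),
    φ ∘ ψ, hφ.comp hψ, hz'⟩

/-- A modulus of continuity shared by a sequence of graphs passes to their Hausdorff limit. -/
theorem dist_snd_le_of_tendsto_hausdorffEDist_graph {X Ξ : Type*} [MetricSpace X]
    [MetricSpace Ξ] {K : ℕ → Set X} {f : ℕ → X → Ξ} {Z : Set (X × Ξ)}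
    (h : Tendsto (fun k => hausdorffEDist ((fun x => (x, f k x)) '' K k) Z) atTop (𝓝 0))
    {ε δ : ℝ} (hmod : ∀ k, ∀ x ∈ K k, ∀ y ∈ K k, dist x y ≤ δ → dist (f k x) (f k y) ≤ ε)
    {p q : X × Ξ} (hp : p ∈ Z) (hq : q ∈ Z) (hpq : dist p.1 q.1 < δ) :
    dist p.2 q.2 ≤ ε := by
  refine le_of_forall_pos_le_add fun η hη => ?_
  have hr : 0 < min (η / 2) ((δ - dist p.1 q.1) / 2) :=
    lt_min (by linarith) (by linarith)
  obtain ⟨k, ⟨_, ⟨x, hx, rfl⟩, hpx⟩, ⟨_, ⟨y, hy, rfl⟩, hqy⟩⟩ :=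
    ((eventually_exists_dist_lt_of_tendsto_hausdorffEDist h hp hr).and
      (eventually_exists_dist_lt_of_tendsto_hausdorffEDist h hq hr)).exists
  simp only [Prod.dist_eq, max_lt_iff, lt_min_iff] at hpx hqy
  have hxy := dist_triangle4 x p.1 q.1 y
  rw [dist_comm x p.1] at hxy
  have hf := hmod k x hx y hy (by linarith)
  have hpq' := dist_triangle4 p.2 (f k x) (f k y) q.2
  rw [dist_comm (f k y) q.2] at hpq'
  linarith

/-- A compact set whose second coordinate is uniformly controlled by the first is the graph of a
continuous function on a compact set. -/
theorem exists_eq_graph_of_dist_snd_le {X Ξ : Type*} [MetricSpace X] [MetricSpace Ξ]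
    (f₀ : X → Ξ) {Z : Set (X × Ξ)} (hZ : IsCompact Z)
    (h : ∀ ε : ℝ, 0 < ε → ∃ δ : ℝ, 0 < δ ∧
      ∀ p ∈ Z, ∀ q ∈ Z, dist p.1 q.1 < δ → dist p.2 q.2 ≤ ε) :
    ∃ L : Set X, IsCompact L ∧ ∃ g : X → Ξ, ContinuousOn g L ∧ (fun x => (x, g x)) '' L = Z := by
  classical
  have hinj : ∀ p ∈ Z, ∀ q ∈ Z, p.1 = q.1 → p.2 = q.2 := fun p hp q hq hpq =>
    eq_of_forall_dist_le fun ε hε => by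
      obtain ⟨δ, hδ, H⟩ := h ε hε
      exact H p hp q hq (by rwa [hpq, dist_self])
  let g : X → Ξ := fun x => if hx : ∃ a, (x, a) ∈ Z then hx.choose else f₀ x
  have hg : ∀ x ∈ Prod.fst '' Z, (x, g x) ∈ Z := by
    rintro _ ⟨p, hp, rfl⟩
    have hx : ∃ a, (p.1, a) ∈ Z := ⟨p.2, hp⟩
    simpa only [g, dif_pos hx] using hx.choose_spec
  refine ⟨Prod.fst '' Z, hZ.image continuous_fst, g, ?_, ?_⟩
  · rw [Metric.continuousOn_iff]
    intro x hx ε hε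
    obtain ⟨δ, hδ, H⟩ := h (ε / 2) (half_pos hε)
    exact ⟨δ, hδ, fun y hy hyx =>
      (H _ (hg y hy) _ (hg x hx) hyx).trans_lt (half_lt_self hε)⟩
  · ext p
    constructor
    · rintro ⟨x, hx, rfl⟩
      exact hg x hx
    · intro hp
      have hp' := mem_image_of_mem Prod.fst hp
      exact ⟨p.1, hp', Prod.ext rfl (hinj _ (hg _ hp') _ hp rfl)⟩

/-- **Arzelà–Ascoli for continuous functions with variable compact domains**: a family
of graphs `Γ_i = {(x, f_i x) : x ∈ K_i}` in `X × Ξ` (max product metric) is precompact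
for the Hausdorff distance — every sequence has a subsequence converging in Hausdorff
distance to the graph of a continuous function on a compact set — iff (1) the domains
are contained in a single compact subset, (2) the values have compact closure, and
(3) the family is uniformly equicontinuous. -/
theorem graph_precompact_iff_arzela_ascoli
    {X Ξ : Type*} [MetricSpace X] [MetricSpace Ξ]
    {ι : Type*} [Nonempty ι]
    (K : ι → Set X) (hK : ∀ i, IsCompact (K i))
    (f : ι → X → Ξ) (hf : ∀ i, ContinuousOn (f i) (K i)) :
    (∀ i : ℕ → ι, ∃ φ : ℕ → ℕ, StrictMono φ ∧
        ∃ L : Set X, IsCompact L ∧ ∃ g : X → Ξ, ContinuousOn g L ∧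
          Tendsto (fun k => EMetric.hausdorffEdist
              ((fun x => (x, f (i (φ k)) x)) '' K (i (φ k)))
              ((fun x => (x, g x)) '' L)) atTop (𝓝 0)) ↔
      ((∃ K₀ : Set X, IsCompact K₀ ∧ ∀ i, K i ⊆ K₀) ∧
       IsCompact (closure {a : Ξ | ∃ i, ∃ x ∈ K i, f i x = a}) ∧
       (∀ ε : ℝ, 0 < ε → ∃ δ : ℝ, 0 < δ ∧ ∀ i, ∀ x ∈ K i, ∀ y ∈ K i,
          dist x y ≤ δ → dist (f i x) (f i y) ≤ ε)) := by
  unfold EMetric.hausdorffEdist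
  constructor
  · intro h
    have hS : IsCompact (closure (⋃ i, (fun x => (x, f i x)) '' K i)) := by
      refine isCompact_closure_iUnion_of_tendsto_hausdorffEDist fun i => ?_
      obtain ⟨φ, hφ, L, hL, g, hg, hlim⟩ := h i
      exact ⟨φ, hφ, _, hL.image_of_continuousOn (continuousOn_id.prodMk hg), hlim⟩
    have hmem : ∀ i, ∀ x ∈ K i, (x, f i x) ∈ closure (⋃ i, (fun x => (x, f i x)) '' K i) :=
      fun i x hx => subset_closure (mem_iUnion.mpr ⟨i, x, hx, rfl⟩)
    refine ⟨⟨_, hS.image continuous_fst, fun i x hx => ⟨_, hmem i x hx, rfl⟩⟩,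
      (hS.image continuous_snd).closure_of_subset ?_, ?_⟩
    · rintro _ ⟨i, x, hx, rfl⟩
      exact ⟨_, hmem i x hx, rfl⟩
    · intro ε hε
      by_contra! hcon
      choose i x hx y hy hxy hfxy using fun n : ℕ =>
        hcon (1 / ((n : ℝ) + 1)) Nat.one_div_pos_of_nat
      obtain ⟨φ, hφ, L, hL, g, hg, hlim⟩ := h i
      have hG := hL.image_of_continuousOn (continuousOn_id.prodMk hg)
      obtain ⟨_, ⟨a, ha, rfl⟩, ψ, hψ, hxa⟩ :=
        exists_tendsto_subseq_of_tendsto_hausdorffEDist hG hlim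
          (w := fun k => (x (φ k), f (i (φ k)) (x (φ k)))) fun k => ⟨_, hx (φ k), rfl⟩
      obtain ⟨_, ⟨b, hb, rfl⟩, χ, hχ, hyb⟩ :=
        exists_tendsto_subseq_of_tendsto_hausdorffEDist hG (hlim.comp hψ.tendsto_atTop)
          (w := fun k => (y (φ (ψ k)), f (i (φ (ψ k))) (y (φ (ψ k)))))
          fun k => ⟨_, hy (φ (ψ k)), rfl⟩
      replace hxa := hxa.comp hχ.tendsto_atTop
      have hdist : Tendsto (fun n => dist (x n) (y n)) atTop (𝓝 0) :=
        squeeze_zero (fun _ => dist_nonneg) hxy tendsto_one_div_add_atTop_nhds_zero_nat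
      have hab : a = b := dist_eq_zero.mp <| tendsto_nhds_unique
        (((continuous_fst.tendsto _).comp hxa).dist ((continuous_fst.tendsto _).comp hyb))
        (hdist.comp (hφ.comp (hψ.comp hχ)).tendsto_atTop)
      have hle : ε ≤ dist (g a) (g b) := ge_of_tendsto
        (((continuous_snd.tendsto _).comp hxa).dist ((continuous_snd.tendsto _).comp hyb))
        (Eventually.of_forall fun _ => (hfxy _).le)
      rw [hab, dist_self] at hle
      exact hle.not_gt hε
  · rintro ⟨⟨K₀, hK₀, hsub⟩, hC, hmod⟩ i
    obtain ⟨φ, hφ, Z, hZ, hlim⟩ := (hK₀.prod hC).exists_tendsto_hausdorffEDist_subseq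
      (s := fun n => (fun x => (x, f (i n) x)) '' K (i n))
      (fun n => ((hK _).image_of_continuousOn (continuousOn_id.prodMk (hf _))).isClosed) (by
        rintro n _ ⟨x, hx, rfl⟩
        exact ⟨hsub _ hx, subset_closure ⟨_, x, hx, rfl⟩⟩)
    obtain ⟨L, hL, g, hg, rfl⟩ := exists_eq_graph_of_dist_snd_le (f (i 0)) hZ fun ε hε => by
      obtain ⟨δ, hδ, H⟩ := hmod ε hε
      exact ⟨δ, hδ, fun p hp q hq hpq =>
        dist_snd_le_of_tendsto_hausdorffEDist_graph hlim (fun k => H _) hp hq hpq⟩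
    exact ⟨φ, hφ, L, hL, g, hg, hlim⟩
end

section
/- Let X be a proper metric space and Ξ a Polish (complete separable metrizable) metric space, and equip X × Ξ with the max product metric. Consider the space of nonempty compact subsets of X × Ξ with the Hausdorff metric, and in it the subset 𝒢 := { G : G = {(x, f(x)) : x ∈ K} for some nonempty compact K ⊆ X and some f : X → Ξ continuous on K }. Then 𝒢, with the subspace topology induced by the Hausdorff metric, is a Polish space. -/
open Metric Set TopologicalSpace

/-- A countable intersection of Polish subspaces of a Polish space is Polish. -/
theorem polishSpace_iInter {α ι : Type*} [TopologicalSpace α] [PolishSpace α] [Countable ι]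
    (s : ι → Set α) (hs : ∀ i, PolishSpace (s i)) : PolishSpace (⋂ i, s i : Set α) := by
  let e : (⋂ i, s i : Set α) → α × (∀ i, s i) :=
    fun x => (x, fun i => ⟨x, mem_iInter.1 x.2 i⟩)
  have he : Continuous e := by fun_prop
  have hrange : range e = {p | ∀ i, (p.2 i : α) = p.1} := by
    ext p
    constructor
    · rintro ⟨x, rfl⟩ i
      rfl
    · intro hp
      exact ⟨⟨p.1, mem_iInter.2 fun i => hp i ▸ (p.2 i).2⟩,
        Prod.ext rfl (funext fun i => Subtype.ext (hp i).symm)⟩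
  refine Topology.IsClosedEmbedding.polishSpace (f := e) ⟨?_, ?_⟩
  · exact .of_comp he continuous_fst Topology.IsEmbedding.subtypeVal
  · rw [hrange, ofPred_forall]
    exact isClosed_iInter fun i => isClosed_eq (by fun_prop) continuous_fst

/-- The nonempty compact subsets of a Polish space form a Polish space. -/
theorem polishSpace_nonemptyCompacts {α : Type*} [TopologicalSpace α] [PolishSpace α] :
    PolishSpace (NonemptyCompacts α) := by
  let := upgradeIsCompletelyMetrizable α
  infer_instance

/-- A function whose graph over a set is compact is continuous on that set. -/
theorem continuousOn_of_isCompact_graph {X Y : Type*} [TopologicalSpace X] [T2Space X]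
    [TopologicalSpace Y] {K : Set X} {f : X → Y}
    (h : IsCompact ((fun x => (x, f x)) '' K)) : ContinuousOn f K := by
  rw [continuousOn_iff_isClosed]
  intro t ht
  refine ⟨Prod.fst '' ((fun x => (x, f x)) '' K ∩ Prod.snd ⁻¹' t),
    ((h.inter_right (ht.preimage continuous_snd)).image continuous_fst).isClosed, ?_⟩
  ext x
  constructor
  · rintro ⟨hxt, hxK⟩
    exact ⟨⟨(x, f x), ⟨⟨x, hxK, rfl⟩, hxt⟩, rfl⟩, hxK⟩
  · rintro ⟨⟨_, ⟨⟨y, -, rfl⟩, hy⟩, rfl⟩, hxK⟩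
    exact ⟨hy, hxK⟩

/-- A nonempty compact set is the graph of a continuous function on a nonempty compact set if and
only if the first projection is injective on it. -/
theorem exists_continuousOn_graph_iff {X Y : Type*} [TopologicalSpace X] [T2Space X]
    [TopologicalSpace Y] (G : NonemptyCompacts (X × Y)) :
    (∃ (K : Set X) (f : X → Y), K.Nonempty ∧ IsCompact K ∧ ContinuousOn f K ∧
      (G : Set (X × Y)) = (fun x => (x, f x)) '' K) ↔ InjOn Prod.fst (G : Set (X × Y)) := by
  constructor
  · rintro ⟨K, f, -, -, -, hG⟩
    rw [hG]
    rintro _ ⟨x, -, rfl⟩ _ ⟨y, -, rfl⟩ (rfl : x = y)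
    rfl
  · intro hinj
    obtain ⟨p₀, hp₀⟩ := G.nonempty
    have : Nonempty (X × Y) := ⟨p₀⟩
    let f : X → Y := fun x => (Function.invFunOn Prod.fst (G : Set (X × Y)) x).2
    have hf : ∀ p ∈ (G : Set (X × Y)), (p.1, f p.1) = p := fun p hp =>
      Prod.ext rfl (by simp only [f, hinj.leftInvOn_invFunOn hp])
    have hG : (G : Set (X × Y)) = (fun x => (x, f x)) '' (Prod.fst '' (G : Set (X × Y))) := by
      rw [image_image, image_congr hf, image_id']
    exact ⟨Prod.fst '' (G : Set (X × Y)), f, G.nonempty.image _,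
      G.isCompact.image continuous_fst, continuousOn_of_isCompact_graph (hG ▸ G.isCompact), hG⟩

/-- Having all vertical fibres of diameter less than `ε` is an open condition on compact sets. -/
theorem isOpen_setOf_dist_snd_lt {X Y : Type*} [TopologicalSpace X] [T2Space X]
    [PseudoMetricSpace Y] (ε : ℝ) :
    IsOpen {G : NonemptyCompacts (X × Y) |
      ∀ p ∈ G, ∀ q ∈ G, p.1 = q.1 → dist p.2 q.2 < ε} := by
  let W : Set ((X × Y) × (X × Y)) := {r | r.1.1 ≠ r.2.1} ∪ {r | dist r.1.2 r.2.2 < ε}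
  have hW : IsOpen W :=
    (isOpen_ne_fun (by fun_prop) (by fun_prop)).union (isOpen_lt (by fun_prop) (by fun_prop))
  have hprod : Continuous fun G : NonemptyCompacts (X × Y) => G ×ˢ G :=
    NonemptyCompacts.continuous_prod.comp (continuous_id.prodMk continuous_id)
  convert (NonemptyCompacts.isOpen_subsets_of_isOpen hW).preimage hprod using 1
  ext G
  constructor
  · rintro h ⟨p, q⟩ ⟨hp, hq⟩
    exact or_iff_not_imp_left.2 fun hne => h p hp q hq (not_not.1 hne)
  · intro h p hp q hq hpq
    exact (h (show (p, q) ∈ (G : Set (X × Y)) ×ˢ (G : Set (X × Y)) from ⟨hp, hq⟩)).resolve_left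
      fun hne => hne hpq

/-- **Polishness of the space of graphs of continuous functions with nonempty compact
domains**: if `X` is a proper metric space and `Ξ` is a Polish metric space, then the
collection of graphs `{(x, f x) : x ∈ K}` of functions `f` continuous on a nonempty
compact `K ⊆ X`, viewed as a subspace of the nonempty compact subsets of `X × Ξ` with
the Hausdorff metric, is a Polish space. -/
theorem polishSpace_graphs
    {X Ξ : Type*} [MetricSpace X] [ProperSpace X] [MetricSpace Ξ] [PolishSpace Ξ] :
    PolishSpace ({G : NonemptyCompacts (X × Ξ) |
      ∃ (K : Set X) (f : X → Ξ), K.Nonempty ∧ IsCompact K ∧ ContinuousOn f K ∧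
        (G : Set (X × Ξ)) = (fun x => (x, f x)) '' K} :
      Set (NonemptyCompacts (X × Ξ))) := by
  have : PolishSpace (NonemptyCompacts (X × Ξ)) := polishSpace_nonemptyCompacts
  have hset : {G : NonemptyCompacts (X × Ξ) |
      ∃ (K : Set X) (f : X → Ξ), K.Nonempty ∧ IsCompact K ∧ ContinuousOn f K ∧
        (G : Set (X × Ξ)) = (fun x => (x, f x)) '' K} =
      ⋂ n : ℕ, {G : NonemptyCompacts (X × Ξ) |
        ∀ p ∈ G, ∀ q ∈ G, p.1 = q.1 → dist p.2 q.2 < 1 / ((n : ℝ) + 1)} := by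
    ext G
    rw [mem_ofPred_eq, exists_continuousOn_graph_iff, mem_iInter]
    constructor
    · intro h n p hp q hq hpq
      rw [h hp hq hpq, dist_self]
      positivity
    · intro h p hp q hq hpq
      refine Prod.ext hpq (eq_of_forall_dist_le fun ε hε => ?_)
      obtain ⟨n, hn⟩ := exists_nat_one_div_lt hε
      exact ((h n p hp q hq hpq).trans hn).le
  rw [hset]
  exact polishSpace_iInter _ fun n => (isOpen_setOf_dist_snd_lt _).polishSpace
end

section
/- Let (K_n)_{n∈ℕ} and L be nonempty compact metric spaces, and suppose the Gromov–Hausdorff distances satisfy dGH(K_n, L) → 0 as n → ∞. For a nonempty compact metric space S and ε > 0, let N(S, ε) denote the least number of closed balls of radius ε with centers in S needed to cover S. Then: (1) for every ε > 0, N(L, ε) ≤ liminf_{n→∞} N(K_n, ε); (2) for every ε > 0 such that there exists ε′ with 0 < ε′ < ε and N(L, ε′) = N(L, ε), one has N(K_n, ε) → N(L, ε) as n → ∞ (i.e. N(K_n, ε) = N(L, ε) for all sufficiently large n). -/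
open Metric Set Filter
open scoped ENNReal Topology

/-- The covering number (metric entropy) `N(S, ε)`: the least cardinality of a finite
set `A ⊆ S` such that the closed balls of radius `ε` centered at the points of `A`
cover `S`. -/
noncomputable def coveringNumber (S : Type*) [MetricSpace S] (ε : ℝ) : ℕ :=
  sInf {n : ℕ | ∃ A : Finset S, A.card = n ∧ ∀ x : S, ∃ a ∈ A, dist x a ≤ ε}

/-- A bound on the covering number amounts to a cover by an indexed family of closed balls,
repetitions allowed. -/
theorem coveringNumber_le_iff {S : Type*} [MetricSpace S] [CompactSpace S] [Nonempty S]
    {ε : ℝ} (hε : 0 < ε) {m : ℕ} :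
    coveringNumber S ε ≤ m ↔ ∃ c : Fin m → S, ∀ x, ∃ i, dist x (c i) ≤ ε := by
  classical
  constructor
  · intro h
    have hne : {n : ℕ | ∃ A : Finset S, A.card = n ∧ ∀ x : S, ∃ a ∈ A, dist x a ≤ ε}.Nonempty := by
      obtain ⟨t, -, ht, hcov⟩ := (isCompact_univ (X := S)).finite_cover_balls hε
      refine ⟨_, ht.toFinset, rfl, fun x => ?_⟩
      obtain ⟨a, ha, hxa⟩ := mem_iUnion₂.1 (hcov (mem_univ x))
      exact ⟨a, ht.mem_toFinset.2 ha, (mem_ball.1 hxa).le⟩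
    obtain ⟨A, hA, hcov⟩ := Nat.sInf_mem hne
    obtain ⟨a₀, ha₀, -⟩ := hcov (Classical.arbitrary S)
    have : Nonempty A := ⟨⟨a₀, ha₀⟩⟩
    have hcard : Fintype.card A ≤ Fintype.card (Fin m) := by
      simpa using hA.trans_le h
    obtain ⟨e⟩ := Function.Embedding.nonempty_of_card_le hcard
    refine ⟨fun i => (Function.invFun e i : A), fun x => ?_⟩
    obtain ⟨a, ha, hxa⟩ := hcov x
    refine ⟨e ⟨a, ha⟩, ?_⟩
    simpa only [Function.leftInverse_invFun e.injective ⟨a, ha⟩] using hxa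
  · rintro ⟨c, hc⟩
    have hcard : (Finset.univ.image c).card ≤ m := by
      simpa using Finset.card_image_le (s := Finset.univ) (f := c)
    refine le_trans (Nat.sInf_le ?_) hcard
    refine ⟨Finset.univ.image c, rfl, fun x => ?_⟩
    obtain ⟨i, hi⟩ := hc x
    exact ⟨c i, Finset.mem_image_of_mem c (Finset.mem_univ i), hi⟩

/-- Covering numbers of Gromov–Hausdorff close spaces compare after enlarging the radius. -/
theorem coveringNumber_le_of_ghDist_lt {X Y : Type*}
    [MetricSpace X] [CompactSpace X] [Nonempty X] [MetricSpace Y] [CompactSpace Y] [Nonempty Y]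
    {δ ε : ℝ} (hε : 0 < ε) (h : GromovHausdorff.ghDist X Y < δ) :
    coveringNumber Y (ε + 2 * δ) ≤ coveringNumber X ε ∧
      coveringNumber X (ε + 2 * δ) ≤ coveringNumber Y ε := by
  obtain ⟨Φ, Ψ, hΦ, hΨ, hd⟩ := GromovHausdorff.ghDist_eq_hausdorffDist X Y
  rw [hd] at h
  have hδ : 0 < δ := hausdorffDist_nonneg.trans_lt h
  have hfin : hausdorffEDist (range Φ) (range Ψ) ≠ ⊤ :=
    hausdorffEDist_ne_top_of_nonempty_of_bounded (range_nonempty Φ) (range_nonempty Ψ)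
      (isCompact_range hΦ.continuous).isBounded (isCompact_range hΨ.continuous).isBounded
  have hXY (x : X) : ∃ y : Y, dist (Φ x) (Ψ y) < δ := by
    simpa using exists_dist_lt_of_hausdorffDist_lt (mem_range_self x) h hfin
  have hYX (y : Y) : ∃ x : X, dist (Φ x) (Ψ y) < δ := by
    simpa using exists_dist_lt_of_hausdorffDist_lt' (mem_range_self y) h hfin
  choose f hf using hXY
  choose g hg using hYX
  constructor
  · obtain ⟨c, hc⟩ := (coveringNumber_le_iff (S := X) hε).1 le_rfl
    refine (coveringNumber_le_iff (by positivity)).2 ⟨f ∘ c, fun y => ?_⟩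
    obtain ⟨i, hi⟩ := hc (g y)
    refine ⟨i, ?_⟩
    rw [← hΦ.dist_eq] at hi
    rw [← hΨ.dist_eq, Function.comp_apply]
    have h₁ := hg y
    have h₂ := hf (c i)
    rw [dist_comm] at h₁
    linarith [dist_triangle4 (Ψ y) (Φ (g y)) (Φ (c i)) (Ψ (f (c i)))]
  · obtain ⟨c, hc⟩ := (coveringNumber_le_iff (S := Y) hε).1 le_rfl
    refine (coveringNumber_le_iff (by positivity)).2 ⟨g ∘ c, fun x => ?_⟩
    obtain ⟨i, hi⟩ := hc (f x)
    refine ⟨i, ?_⟩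
    rw [← hΨ.dist_eq] at hi
    rw [← hΦ.dist_eq, Function.comp_apply]
    have h₁ := hf x
    have h₂ := hg (c i)
    rw [dist_comm] at h₂
    linarith [dist_triangle4 (Φ x) (Ψ (f x)) (Ψ (c i)) (Φ (g (c i)))]

/-- If the space can be covered by `m` closed balls of radius `r` for every `r > ε`, then it can
be covered by `m` closed balls of radius `ε`. -/
theorem coveringNumber_le_of_forall_gt {S : Type*} [MetricSpace S] [CompactSpace S] [Nonempty S]
    {ε : ℝ} (hε : 0 < ε) {m : ℕ} (h : ∀ r, ε < r → coveringNumber S r ≤ m) :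
    coveringNumber S ε ≤ m := by
  obtain ⟨u, hu_anti, hu_gt, hu_lim⟩ := exists_seq_strictAnti_tendsto ε
  let C : ℕ → Set (Fin m → S) := fun k => ⋂ x, ⋃ i, {c | dist x (c i) ≤ u k}
  have hC_closed (k) : IsClosed (C k) :=
    isClosed_iInter fun x => isClosed_iUnion_of_finite fun i =>
      isClosed_le (by fun_prop) continuous_const
  have hC_ne (k) : (C k).Nonempty := by
    obtain ⟨c, hc⟩ := (coveringNumber_le_iff (hε.trans (hu_gt k))).1 (h _ (hu_gt k))
    exact ⟨c, by simpa [C] using hc⟩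
  have hC_anti (k) : C (k + 1) ⊆ C k :=
    iInter_mono fun x => iUnion_mono fun i c hc =>
      le_trans hc (hu_anti (Nat.lt_succ_self k)).le
  obtain ⟨c, hc⟩ := IsCompact.nonempty_iInter_of_sequence_nonempty_isCompact_isClosed C hC_anti
    hC_ne (hC_closed 0).isCompact hC_closed
  have hc' : ∀ k x, ∃ i, dist x (c i) ≤ u k := by simpa [C] using hc
  refine (coveringNumber_le_iff hε).2 ⟨c, fun x => ?_⟩
  obtain ⟨i₀, -⟩ := hc' 0 x
  have : Nonempty (Fin m) := ⟨i₀⟩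
  obtain ⟨i, hi⟩ := Finite.exists_min fun i => dist x (c i)
  refine ⟨i, ge_of_tendsto' hu_lim fun k => ?_⟩
  obtain ⟨j, hj⟩ := hc' k x
  exact (hi j).trans hj

/-- Right-continuity of the covering number, as an inequality. -/
theorem exists_gt_coveringNumber_le {S : Type*} [MetricSpace S] [CompactSpace S] [Nonempty S]
    {ε : ℝ} (hε : 0 < ε) : ∃ r, ε < r ∧ coveringNumber S ε ≤ coveringNumber S r := by
  by_contra! h
  have h₁ : coveringNumber S ε ≤ coveringNumber S ε - 1 :=
    coveringNumber_le_of_forall_gt hε fun r hr => Nat.le_sub_one_of_lt (h r hr)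
  have h₂ := h (ε + 1) (by linarith)
  omega

/-- **Convergence of metric entropies along Gromov–Hausdorff convergence**: if nonempty
compact metric spaces `K_n` converge to `L` in the Gromov–Hausdorff distance, then
(1) `N(L, ε) ≤ liminf_n N(K_n, ε)` for every `ε > 0`, and (2) for every `ε > 0` that is
a continuity point of `N(L, ·)` (i.e. `N(L, ε') = N(L, ε)` for some `0 < ε' < ε`),
`N(K_n, ε) = N(L, ε)` for all sufficiently large `n`. -/
theorem coveringNumber_tendsto_of_ghDist_tendsto
    {K : ℕ → Type*} [∀ n, MetricSpace (K n)] [∀ n, CompactSpace (K n)] [∀ n, Nonempty (K n)]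
    {L : Type*} [MetricSpace L] [CompactSpace L] [Nonempty L]
    (hconv : Tendsto (fun n => GromovHausdorff.ghDist (K n) L) atTop (𝓝 0)) :
    (∀ ε : ℝ, 0 < ε →
        (coveringNumber L ε : ℝ≥0∞)
          ≤ Filter.liminf (fun n => (coveringNumber (K n) ε : ℝ≥0∞)) atTop) ∧
    (∀ ε : ℝ, 0 < ε →
        (∃ ε' : ℝ, 0 < ε' ∧ ε' < ε ∧ coveringNumber L ε' = coveringNumber L ε) →
        ∀ᶠ n in atTop, coveringNumber (K n) ε = coveringNumber L ε) := by
  have lower : ∀ ε : ℝ, 0 < ε →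
      ∀ᶠ n in atTop, coveringNumber L ε ≤ coveringNumber (K n) ε := by
    intro ε hε
    obtain ⟨r, hr, hle⟩ := exists_gt_coveringNumber_le (S := L) hε
    filter_upwards [hconv.eventually_lt_const (show 0 < (r - ε) / 2 by linarith)] with n hn
    have := (coveringNumber_le_of_ghDist_lt hε hn).1
    rw [show ε + 2 * ((r - ε) / 2) = r by ring] at this
    exact hle.trans this
  refine ⟨fun ε hε => le_liminf_of_le (by isBoundedDefault) ?_, ?_⟩
  · filter_upwards [lower ε hε] with n hn
    exact_mod_cast hn
  · rintro ε hε ⟨ε', hε', hlt, heq⟩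
    filter_upwards [lower ε hε,
      hconv.eventually_lt_const (show 0 < (ε - ε') / 2 by linarith)] with n hn hn'
    have := (coveringNumber_le_of_ghDist_lt hε' hn').2
    rw [show ε' + 2 * ((ε - ε') / 2) = ε by ring, heq] at this
    exact this.antisymm hn
end

section
/- For each n ∈ ℕ let (X_n, ρ_n) be a pointed proper metric space, and let (X_∞, ρ_∞) be a pointed proper metric space. Then the following are equivalent. (A) There exist a proper metric space M, a point ρ_M ∈ M, and isometric embeddings f_n : X_n → M for n ∈ ℕ ∪ {∞} with f_n(ρ_n) = ρ_M for all n ∈ ℕ ∪ {∞}, such that the closed sets f_n(X_n) converge to f_∞(X_∞) in the Fell/Painlevé–Kuratowski sense in M. (B) There exist a proper metric space M and isometric embeddings f_n : X_n → M for n ∈ ℕ ∪ {∞} such that f_n(X_n) converges to f_∞(X_∞) in the Fell/Painlevé–Kuratowski sense in M and dist(f_n(ρ_n), f_∞(ρ_∞)) → 0. -/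
open Filter Set
open scoped Topology

universe u

/-- Fell/Painlevé–Kuratowski convergence of a sequence of subsets of a metric space:
(upper) any limit of points `y_k ∈ A (φ k)` along a subsequence belongs to `B`, and
(lower) every point of `B` is the limit of points `y_n ∈ A n` for all sufficiently
large `n`. -/
def FellPKConv {M : Type*} [MetricSpace M] (A : ℕ → Set M) (B : Set M) : Prop :=
  (∀ φ : ℕ → ℕ, StrictMono φ → ∀ y : ℕ → M, (∀ k, y k ∈ A (φ k)) →
      ∀ z : M, Tendsto y atTop (𝓝 z) → z ∈ B) ∧
  (∀ z ∈ B, ∃ y : ℕ → M, (∀ᶠ n in atTop, y n ∈ A n) ∧ Tendsto y atTop (𝓝 z))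

/-- The product `K × M`, to be equipped with the pseudometric obtained from the `ℓ¹` product metric
by collapsing the diagonal `{(q, q) | q ∈ K}` to a point. -/
structure DiagCollapse {M : Type u} (K : Set M) : Type u where
  /-- The base point. -/
  base : K
  /-- The moving point. -/
  pt : M

namespace DiagCollapse

variable {M : Type u} [MetricSpace M] {K : Set M}

noncomputable instance : PseudoMetricSpace (DiagCollapse K) where
  dist a b := min (dist a.pt b.pt + dist a.base b.base)
    (dist a.pt (a.base : M) + dist b.pt (b.base : M))
  dist_self a := by
    rw [dist_self, dist_self, add_zero]
    exact min_eq_left (by positivity)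
  dist_comm a b := by
    rw [dist_comm a.pt b.pt, dist_comm a.base b.base, add_comm (dist a.pt (a.base : M))]
  dist_triangle a b c := by
    have h₁ := dist_triangle a.pt b.pt c.pt
    have h₂ := dist_triangle a.base b.base c.base
    have h₃ := dist_triangle4 a.pt b.pt (b.base : M) (a.base : M)
    have h₄ := dist_triangle4 c.pt b.pt (b.base : M) (c.base : M)
    rw [dist_comm (b.base : M)] at h₃
    rw [dist_comm c.pt b.pt] at h₄
    have h₅ : 0 ≤ dist b.pt (b.base : M) := dist_nonneg
    simp only [Subtype.dist_eq] at *
    rw [← min_add_add_right, ← min_add_add_left, ← min_add_add_left]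
    refine le_min (le_min ?_ ?_) (le_min ?_ ?_)
    · exact (min_le_left _ _).trans (by linarith)
    all_goals exact (min_le_right _ _).trans (by linarith)

theorem dist_def (a b : DiagCollapse K) :
    dist a b = min (dist a.pt b.pt + dist (a.base : M) b.base)
      (dist a.pt (a.base : M) + dist b.pt (b.base : M)) := rfl

theorem continuous_mk : Continuous fun x : K × M => (⟨x.1, x.2⟩ : DiagCollapse K) := by
  refine (LipschitzWith.of_dist_le_mul (K := 2) fun x y => ?_).continuous
  have h₁ : dist x.1 y.1 ≤ dist x y := le_max_left _ _
  have h₂ : dist x.2 y.2 ≤ dist x y := le_max_right _ _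
  refine (min_le_left _ _).trans ?_
  push_cast
  linarith

theorem isometry_mk (q : K) : Isometry fun x : M => (⟨q, x⟩ : DiagCollapse K) := by
  refine Isometry.of_dist_eq fun x y => ?_
  simp only [dist_def, dist_self, add_zero]
  exact min_eq_left (dist_triangle_right _ _ _)

/-- The canonical map to the metric quotient. -/
noncomputable def toQuotient (q : K) (x : M) : SeparationQuotient (DiagCollapse K) :=
  SeparationQuotient.mk ⟨q, x⟩

theorem continuous_toQuotient : Continuous fun x : K × M => toQuotient x.1 x.2 :=
  SeparationQuotient.continuous_mk.comp continuous_mk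

theorem isometry_toQuotient (q : K) : Isometry (toQuotient q) :=
  Isometry.of_dist_eq (isometry_mk q).dist_eq

theorem dist_toQuotient (q r : K) (x y : M) :
    dist (toQuotient q x) (toQuotient r y) =
      min (dist x y + dist (q : M) r) (dist x (q : M) + dist y (r : M)) := rfl

theorem toQuotient_self (q r : K) : toQuotient q (q : M) = toQuotient r (r : M) := by
  refine dist_le_zero.1 ?_
  rw [dist_toQuotient]
  exact (min_le_right _ _).trans (by simp)

theorem exists_toQuotient (z : SeparationQuotient (DiagCollapse K)) :
    ∃ q x, toQuotient q x = z := by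
  obtain ⟨⟨q, x⟩, rfl⟩ := SeparationQuotient.surjective_mk z
  exact ⟨q, x, rfl⟩

theorem properSpace_separationQuotient [ProperSpace M] (hK : IsCompact K) :
    ProperSpace (SeparationQuotient (DiagCollapse K)) := by
  have : CompactSpace K := isCompact_iff_compactSpace.1 hK
  refine ⟨fun a r => ?_⟩
  obtain ⟨q, x, rfl⟩ := exists_toQuotient a
  have hc : IsCompact ((fun y : K × M => toQuotient y.1 y.2) ⁻¹'
      Metric.closedBall (toQuotient q x) r) := by
    refine Metric.isCompact_of_isClosed_isBounded
      (Metric.isClosed_closedBall.preimage continuous_toQuotient) ?_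
    obtain ⟨C, hC⟩ := hK.isBounded.subset_closedBall (q : M)
    refine ((isCompact_univ (X := K)).isBounded.prod
      (Metric.isBounded_closedBall (x := (q : M)) (r := r + dist x (q : M) + C))).subset ?_
    rintro ⟨s, y⟩ hy
    refine ⟨mem_univ _, ?_⟩
    have hs : dist (s : M) q ≤ C := hC s.2
    have h₁ : dist (toQuotient s y) (toQuotient q x) ≤ r := hy
    have h₂ := dist_triangle (toQuotient s y) (toQuotient q x) (toQuotient q (q : M))
    rw [(isometry_toQuotient q).dist_eq, toQuotient_self q s,
      (isometry_toQuotient s).dist_eq] at h₂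
    have h₃ := dist_triangle y (s : M) q
    simp only [Metric.mem_closedBall]
    linarith
  have himage := hc.image continuous_toQuotient
  rwa [image_preimage_eq] at himage
  intro z
  obtain ⟨s, y, h⟩ := exists_toQuotient z
  exact ⟨(s, y), h⟩

/-- Convergence to a point off the diagonal can be checked coordinatewise. -/
theorem tendsto_of_tendsto_toQuotient {ι : Type*} {l : Filter ι} {q : ι → K} {x : ι → M} {r : K}
    {y : M} (h : Tendsto (fun i => toQuotient (q i) (x i)) l (𝓝 (toQuotient r y)))
    (hy : y ≠ r) :
    Tendsto (fun i => (q i : M)) l (𝓝 (r : M)) ∧ Tendsto x l (𝓝 y) := by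
  rw [tendsto_iff_dist_tendsto_zero] at h
  have hsum : Tendsto (fun i => dist (x i) y + dist (q i : M) r) l (𝓝 0) := by
    refine h.congr' ?_
    filter_upwards [h.eventually_lt_const (dist_pos.2 hy)] with i hi
    rw [dist_toQuotient] at hi ⊢
    have h₀ : 0 ≤ dist (x i) (q i : M) := dist_nonneg
    rcases min_lt_iff.1 hi with h | h
    · exact min_eq_left (by linarith)
    · linarith
  constructor <;> rw [tendsto_iff_dist_tendsto_zero]
  · exact squeeze_zero (fun _ => dist_nonneg) (fun _ => le_add_of_nonneg_left dist_nonneg) hsum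
  · exact squeeze_zero (fun _ => dist_nonneg) (fun _ => le_add_of_nonneg_right dist_nonneg) hsum

theorem fellPKConv_image {A : ℕ → Set M} {B : Set M} (hAB : FellPKConv A B) {q : ℕ → K} {r : K}
    (hq : Tendsto q atTop (𝓝 r)) (hr : (r : M) ∈ B) :
    FellPKConv (fun n => toQuotient (q n) '' A n) (toQuotient r '' B) := by
  constructor
  · intro φ hφ y hy z hz
    choose x hx hxy using hy
    obtain rfl : (fun k => toQuotient (q (φ k)) (x k)) = y := funext hxy
    obtain ⟨s, w, rfl⟩ := exists_toQuotient z
    by_cases hw : w = s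
    · exact ⟨r, hr, by rw [hw, toQuotient_self]⟩
    · obtain ⟨h₁, h₂⟩ := tendsto_of_tendsto_toQuotient hz hw
      obtain rfl : s = r :=
        tendsto_nhds_unique (tendsto_subtype_rng.2 h₁) (hq.comp hφ.tendsto_atTop)
      exact ⟨w, hAB.1 φ hφ x hx w h₂, rfl⟩
  · rintro _ ⟨z, hz, rfl⟩
    obtain ⟨y, hy, hyz⟩ := hAB.2 z hz
    exact ⟨fun n => toQuotient (q n) (y n), hy.mono fun n h => mem_image_of_mem _ h,
      (continuous_toQuotient.tendsto (r, z)).comp (hq.prodMk_nhds hyz)⟩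

end DiagCollapse

/-- **Equivalence of the root-preserving and non-root-preserving formulations of local
Gromov–Hausdorff convergence of pointed proper metric spaces**: there exist
root-preserving isometric embeddings of the `(X_n, ρ_n)` and `(X_∞, ρ_∞)` into a common
pointed proper metric space under which the images converge in the Fell/PK sense iff
there exist isometric embeddings into a common proper metric space under which the
images converge in the Fell/PK sense and the images of the roots converge. -/
theorem rootPreserving_iff_nonRootPreserving_embedding
    {X : ℕ → Type u} [∀ n, MetricSpace (X n)] [∀ n, ProperSpace (X n)] (ρ : ∀ n, X n)
    {Xinf : Type u} [MetricSpace Xinf] [ProperSpace Xinf] (ρinf : Xinf) :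
    (∃ (M : Type u) (_ : MetricSpace M), ProperSpace M ∧
        ∃ (ρM : M) (f : ∀ n, X n → M) (finf : Xinf → M),
          (∀ n, Isometry (f n)) ∧ Isometry finf ∧
          (∀ n, f n (ρ n) = ρM) ∧ finf ρinf = ρM ∧
          FellPKConv (fun n => Set.range (f n)) (Set.range finf)) ↔
    (∃ (M : Type u) (_ : MetricSpace M), ProperSpace M ∧
        ∃ (f : ∀ n, X n → M) (finf : Xinf → M),
          (∀ n, Isometry (f n)) ∧ Isometry finf ∧
          FellPKConv (fun n => Set.range (f n)) (Set.range finf) ∧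
          Tendsto (fun n => dist (f n (ρ n)) (finf ρinf)) atTop (𝓝 0)) := by
  constructor
  · rintro ⟨M, _, hM, ρM, f, finf, hf, hfinf, hρ, hρinf, hconv⟩
    exact ⟨M, inferInstance, hM, f, finf, hf, hfinf, hconv, by simp [hρ, hρinf]⟩
  · rintro ⟨M, _, hM, f, finf, hf, hfinf, hconv, hρ⟩
    have hlim : Tendsto (fun n => f n (ρ n)) atTop (𝓝 (finf ρinf)) :=
      tendsto_iff_dist_tendsto_zero.2 hρ
    let K : Set M := insert (finf ρinf) (range fun n => f n (ρ n))
    let q : ℕ → K := fun n => ⟨f n (ρ n), mem_insert_of_mem _ (mem_range_self n)⟩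
    let r : K := ⟨finf ρinf, mem_insert _ _⟩
    have hq : Tendsto q atTop (𝓝 r) := tendsto_subtype_rng.2 hlim
    refine ⟨SeparationQuotient (DiagCollapse K), inferInstance,
      DiagCollapse.properSpace_separationQuotient hlim.isCompact_insert_range,
      DiagCollapse.toQuotient r (r : M), fun n => DiagCollapse.toQuotient (q n) ∘ f n,
      DiagCollapse.toQuotient r ∘ finf,
      fun n => (DiagCollapse.isometry_toQuotient _).comp (hf n),
      (DiagCollapse.isometry_toQuotient _).comp hfinf,
      fun n => DiagCollapse.toQuotient_self (q n) r, rfl, ?_⟩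
    simp only [range_comp]
    exact DiagCollapse.fellPKConv_image hconv hq (mem_range_self ρinf)
end
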